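/- arXiv:math-ph/0403029 — 3 statements merged into one kernel-verified Lean document; each statement's English description precedes it below -/
import Mathlib

section
/- For every fixed 1 ≤ i ≤ k, the i-th largest eigenvalue λ_i(B_β) of B_β converges in probability, as β → ∞, to the constant l_i^{(k)}/k, where l_1^{(k)} > ⋯ > l_k^{(k)} are the roots of the k-th Laguerre polynomial L_k^{γ−1} of parameter γ−1. -/
open MeasureTheory ProbabilityTheory Filter Polynomial Matrix Topology Asymptotics

instance matrixMeasurableSpace {m n α : Type*} [MeasurableSpace α] :
    MeasurableSpace (Matrix m n α) := MeasurableSpace.pi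

noncomputable section

/-- The chi distribution with parameter `r`: the measure on `ℝ` with density
`2^(1-r/2) x^(r-1) e^(-x²/2) / Γ(r/2)` on `(0,∞)`. -/
def chiMeasure (r : ℝ) : Measure ℝ :=
  volume.withDensity fun x => ENNReal.ofReal
    (Set.indicator (Set.Ioi (0:ℝ))
      (fun x => (2:ℝ) ^ (1 - r / 2) * x ^ (r - 1) * Real.exp (-x ^ 2 / 2) / Real.Gamma (r / 2)) x)

/-- The `i`-th largest root of the characteristic polynomial (counted with multiplicity);
for a real symmetric matrix this is its `i`-th largest eigenvalue. -/
def ithLargestEig {n : ℕ} (M : Matrix (Fin n) (Fin n) ℝ) (i : Fin n) : ℝ :=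
  (M.charpoly.roots.sort (· ≤ ·)).getD (n - 1 - (i : ℕ)) 0

def finL {k : ℕ} (l : Fin (k - 1)) : Fin k := ⟨l, by have := l.isLt; omega⟩
def finR {k : ℕ} (l : Fin (k - 1)) : Fin k := ⟨(l : ℕ) + 1, by have := l.isLt; omega⟩

/-- Symmetric tridiagonal matrix with diagonal `d` and off-diagonal `e`. -/
def symTridiagOf {k : ℕ} (d : Fin k → ℝ) (e : Fin (k - 1) → ℝ) : Matrix (Fin k) (Fin k) ℝ :=
  Matrix.of fun i j =>
    if i = j then d i
    else if h : (i : ℕ) + 1 = (j : ℕ) then e ⟨i, by have := j.isLt; omega⟩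
    else if h' : (j : ℕ) + 1 = (i : ℕ) then e ⟨j, by have := i.isLt; omega⟩
    else 0

/-- Lower bidiagonal matrix with diagonal `d` and subdiagonal `e`. -/
def lowerBidiagOf {k : ℕ} (d : Fin k → ℝ) (e : Fin (k - 1) → ℝ) : Matrix (Fin k) (Fin k) ℝ :=
  Matrix.of fun i j =>
    if i = j then d i
    else if h : (j : ℕ) + 1 = (i : ℕ) then e ⟨j, by have := i.isLt; omega⟩
    else 0

/-- The Hermite polynomials, orthonormal with respect to the weight `e^(-x²)` on `ℝ`,
with positive leading coefficients; they satisfy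
`x·H n x = √((n+1)/2)·H (n+1) x + √(n/2)·H (n-1) x`. -/
def Hpoly : ℕ → ℝ → ℝ
  | 0 => fun _ => Real.pi ^ (-(1:ℝ)/4)
  | 1 => fun x => Real.sqrt 2 * x * Real.pi ^ (-(1:ℝ)/4)
  | (n+2) => fun x =>
      (x * Hpoly (n+1) x - Real.sqrt (((n:ℝ)+1)/2) * Hpoly n x) / Real.sqrt (((n:ℝ)+2)/2)

/-- The monic (probabilists') Hermite polynomials:
`He 0 = 1`, `He 1 = X`, `He (n+1) = X·He n - n·He (n-1)`. -/
def heP : ℕ → Polynomial ℝ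
  | 0 => 1
  | 1 => Polynomial.X
  | (n+2) => Polynomial.X * heP (n+1) - Polynomial.C ((n:ℝ)+1) * heP n

/-- The generalized Laguerre polynomials of parameter `γ`, orthonormal with respect to the
weight `x^γ e^(-x)` on `[0,∞)` (formally defined for all real `γ`), with positive leading
coefficients; they satisfy
`x·L n x = √((n+1)(n+γ+1))·L (n+1) x + (2n+γ+1)·L n x + √(n(n+γ))·L (n-1) x`. -/
def Lag (γ : ℝ) : ℕ → ℝ → ℝ
  | 0 => fun _ => Real.Gamma (γ+1) ^ (-(1:ℝ)/2)
  | 1 => fun x => (x - (γ+1)) * Real.Gamma (γ+1) ^ (-(1:ℝ)/2) / Real.sqrt (γ+1)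
  | (n+2) => fun x =>
      ((x - (2*((n:ℝ)+1)+γ+1)) * Lag γ (n+1) x
        - Real.sqrt (((n:ℝ)+1)*(((n:ℝ)+1)+γ)) * Lag γ n x)
      / Real.sqrt (((n:ℝ)+2)*(((n:ℝ)+2)+γ))

/-- The fixed `k×k` symmetric tridiagonal matrix `H` with zero diagonal and off-diagonal
entries `√(k-j)/√2`, `j = 1,…,k-1`. -/
def hermiteH (k : ℕ) : Matrix (Fin k) (Fin k) ℝ :=
  symTridiagOf (fun _ => 0) (fun j => Real.sqrt ((k:ℝ) - 1 - (j:ℕ)) / Real.sqrt 2)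

/-- The fixed `k×k` lower bidiagonal matrix `B_γ` with diagonal `√(γ+k-j)` and
subdiagonal `√(k-j)`. -/
def lagB (k : ℕ) (γ : ℝ) : Matrix (Fin k) (Fin k) ℝ :=
  lowerBidiagOf (fun j => Real.sqrt (γ + (k:ℝ) - 1 - (j:ℕ)))
    (fun j => Real.sqrt ((k:ℝ) - 1 - (j:ℕ)))

/-- The fixed tridiagonal Laguerre matrix `L_γ = B_γ B_γᵀ`. -/
def lagL (k : ℕ) (γ : ℝ) : Matrix (Fin k) (Fin k) ℝ := lagB k γ * (lagB k γ)ᵀ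

/-- Law of the β-Hermite tridiagonal matrix model of size `k`, scaled by `1/√(2kβ)`:
independent `N(0,1)` diagonal entries and `(1/√2)·χ_((k-j)β)` off-diagonal entries. -/
def hermiteLaw (k : ℕ) (β : ℝ) : Measure (Matrix (Fin k) (Fin k) ℝ) :=
  Measure.map (fun p : (Fin k → ℝ) × (Fin (k-1) → ℝ) =>
      (Real.sqrt (2 * (k:ℝ) * β))⁻¹ • symTridiagOf p.1 p.2)
    ((Measure.pi fun _ : Fin k => gaussianReal 0 1).prod
      (Measure.pi fun j : Fin (k-1) =>
        Measure.map (fun x => x / Real.sqrt 2) (chiMeasure (((k:ℝ) - 1 - (j:ℕ)) * β))))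

/-- Law of the limiting symmetric tridiagonal Gaussian matrix `Z` (Hermite case):
i.i.d. `N(0,1)` diagonal entries and i.i.d. `N(0,1/4)` off-diagonal entries. -/
def zLaw (k : ℕ) : Measure (Matrix (Fin k) (Fin k) ℝ) :=
  Measure.map (fun p : (Fin k → ℝ) × (Fin (k-1) → ℝ) => symTridiagOf p.1 p.2)
    ((Measure.pi fun _ : Fin k => gaussianReal 0 1).prod
      (Measure.pi fun _ : Fin (k-1) => gaussianReal 0 (1/4)))

/-- Law of the β-Laguerre matrix model of size `k` with parameter `a`, scaled by `1/(kβ)`: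
`B = (1/(kβ)) X Xᵀ` with `X` lower bidiagonal, `X_jj ~ χ_(2a-β(j-1))`, `X_(j+1,j) ~ χ_(β(k-j))`. -/
def lagLaw (k : ℕ) (β a : ℝ) : Measure (Matrix (Fin k) (Fin k) ℝ) :=
  Measure.map (fun p : (Fin k → ℝ) × (Fin (k-1) → ℝ) =>
      (((k:ℝ) * β)⁻¹) • (lowerBidiagOf p.1 p.2 * (lowerBidiagOf p.1 p.2)ᵀ))
    ((Measure.pi fun j : Fin k => chiMeasure (2 * a - β * (j:ℕ))).prod
      (Measure.pi fun j : Fin (k-1) => chiMeasure (β * ((k:ℝ) - 1 - (j:ℕ)))))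

/-- Law of the limiting lower bidiagonal Gaussian matrix `Z` (Laguerre case):
i.i.d. `N(0,1)` diagonal and subdiagonal entries. -/
def zBidLaw (k : ℕ) : Measure (Matrix (Fin k) (Fin k) ℝ) :=
  Measure.map (fun p : (Fin k → ℝ) × (Fin (k-1) → ℝ) => lowerBidiagOf p.1 p.2)
    ((Measure.pi fun _ : Fin k => gaussianReal 0 1).prod
      (Measure.pi fun _ : Fin (k-1) => gaussianReal 0 1))

/-- `ν` is the centered `k`-variate Gaussian distribution with covariance matrix `S`:
every linear functional has the corresponding one-dimensional centered Gaussian law. -/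
def IsCenteredGaussianVec {k : ℕ} (ν : Measure (Fin k → ℝ)) (S : Fin k → Fin k → ℝ) : Prop :=
  IsProbabilityMeasure ν ∧ ∀ c : Fin k → ℝ,
    Measure.map (fun x => ∑ i, c i * x i) ν =
      gaussianReal 0 (∑ i, ∑ j, c i * c j * S i j).toNNReal

theorem ithLargestEig_eq_of_strictAnti {n : ℕ} (M : Matrix (Fin n) (Fin n) ℝ) (m : Fin n → ℝ)
    (hm : StrictAnti m) (hroot : ∀ i, M.charpoly.eval (m i) = 0) :
    M.charpoly.roots = (List.ofFn fun j => m j.rev : List ℝ) ∧ ∀ i, ithLargestEig M i = m i := by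
  have hmono : StrictMono fun j : Fin n => m j.rev := fun a b hab => hm (Fin.rev_lt_rev.2 hab)
  have hle : ((List.ofFn fun j => m j.rev : List ℝ) : Multiset ℝ) ≤ M.charpoly.roots := by
    rw [Multiset.le_iff_subset (Multiset.coe_nodup.2 (List.nodup_ofFn.2 hmono.injective))]
    intro x hx
    rw [Multiset.mem_coe, List.mem_ofFn] at hx
    obtain ⟨j, rfl⟩ := hx
    exact (mem_roots (M.charpoly_monic.ne_zero)).2 (hroot _)
  have hroots : M.charpoly.roots = (List.ofFn fun j => m j.rev : List ℝ) := by
    refine (Multiset.eq_of_le_of_card_le hle ?_).symm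
    simpa using M.charpoly.card_roots'
  refine ⟨hroots, fun i => ?_⟩
  have hi := i.isLt
  rw [ithLargestEig, hroots, Multiset.coe_sort, List.mergeSort_of_pairwise,
    List.getD_eq_getElem _ _ (by simp; omega), List.getElem_ofFn]
  · congr 1
    ext
    simp [Fin.val_rev]
    omega
  · rw [List.pairwise_ofFn]
    intro a b hab
    simpa using (hmono hab).le

theorem charpoly_eval_eq_prod_of_strictAnti {n : ℕ} (M : Matrix (Fin n) (Fin n) ℝ) (m : Fin n → ℝ)
    (hm : StrictAnti m) (hroot : ∀ i, M.charpoly.eval (m i) = 0) (x : ℝ) :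
    M.charpoly.eval x = ∏ j, (x - m j) := by
  have hroots := (ithLargestEig_eq_of_strictAnti M m hm hroot).1
  have h := prod_multiset_X_sub_C_of_monic_of_roots_card_eq M.charpoly_monic
    (by rw [hroots]; simp)
  rw [← h, hroots, eval_multiset_prod]
  simp only [Multiset.map_coe, Multiset.prod_coe, List.map_ofFn, List.prod_ofFn]
  simpa using Equiv.prod_comp Fin.revPerm fun j => x - m j

/-- The ordered eigenvalues are continuous at a matrix with simple real spectrum. -/
theorem eventually_ithLargestEig_near {n : ℕ} (M : Matrix (Fin n) (Fin n) ℝ) (m : Fin n → ℝ)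
    (hm : StrictAnti m) (hroot : ∀ i, M.charpoly.eval (m i) = 0) {ε : ℝ} (hε : 0 < ε) :
    ∀ᶠ A in 𝓝 M, ∀ i, |ithLargestEig A i - m i| < ε := by
  obtain ⟨h, h0, hhε, hgap⟩ :
      ∃ h : ℝ, 0 < h ∧ h < ε ∧ ∀ i j : Fin n, i < j → 2 * h < m i - m j := by
    have hev : ∀ᶠ h in 𝓝[>] (0 : ℝ), h < ε ∧ ∀ i j : Fin n, i < j → 2 * h < m i - m j := by
      refine nhdsWithin_le_nhds ((eventually_lt_nhds hε).and ?_)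
      refine eventually_all.2 fun i => eventually_all.2 fun j => ?_
      by_cases hij : i < j
      · filter_upwards [eventually_lt_nhds (half_pos (sub_pos.2 (hm hij)))] with h hh _
        linarith
      · exact Eventually.of_forall fun _ h => absurd h hij
    obtain ⟨h, ⟨h1, h2⟩, h3⟩ := (hev.and self_mem_nhdsWithin).exists
    exact ⟨h, h3, h1, h2⟩
  have hcont (x : ℝ) : Continuous fun A : Matrix (Fin n) (Fin n) ℝ => A.charpoly.eval x := by
    simp only [Matrix.eval_charpoly]
    exact (continuous_const.sub continuous_id).matrix_det
  have hsign (i : Fin n) : M.charpoly.eval (m i - h) * M.charpoly.eval (m i + h) < 0 := by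
    rw [charpoly_eval_eq_prod_of_strictAnti M m hm hroot,
      charpoly_eval_eq_prod_of_strictAnti M m hm hroot, ← Finset.prod_mul_distrib,
      ← Finset.mul_prod_erase _ _ (Finset.mem_univ i)]
    refine mul_neg_of_neg_of_pos (by nlinarith) (Finset.prod_pos fun j hj => ?_)
    rcases lt_or_gt_of_ne (Finset.ne_of_mem_erase hj) with hji | hji
    · have := hgap _ _ hji
      nlinarith
    · have := hgap _ _ hji
      nlinarith
  have hev : ∀ᶠ A in 𝓝 M, ∀ i, A.charpoly.eval (m i - h) * A.charpoly.eval (m i + h) < 0 :=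
    eventually_all.2 fun i =>
      ((hcont _).mul (hcont _)).continuousAt.eventually_lt continuousAt_const (hsign i)
  filter_upwards [hev] with A hA
  have hex (i : Fin n) : ∃ r, |r - m i| ≤ h ∧ A.charpoly.eval r = 0 := by
    have hc : ContinuousOn (fun x => A.charpoly.eval x) (Set.uIcc (m i - h) (m i + h)) :=
      A.charpoly.continuous.continuousOn
    have hz : (0 : ℝ) ∈ Set.uIcc (A.charpoly.eval (m i - h)) (A.charpoly.eval (m i + h)) := by
      rw [Set.mem_uIcc]
      rcases mul_neg_iff.1 (hA i) with ⟨h1, h2⟩ | ⟨h1, h2⟩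
      · exact Or.inr ⟨h2.le, h1.le⟩
      · exact Or.inl ⟨h1.le, h2.le⟩
    obtain ⟨r, hr, hr0⟩ := intermediate_value_uIcc hc hz
    rw [Set.uIcc_of_le (by linarith)] at hr
    exact ⟨r, abs_le.2 ⟨by linarith [hr.1], by linarith [hr.2]⟩, hr0⟩
  choose r hr hr0 using hex
  have hanti : StrictAnti r := fun i j hij => by
    have := hgap i j hij
    have h1 := abs_le.1 (hr i)
    have h2 := abs_le.1 (hr j)
    linarith [h1.1, h2.2]
  intro i
  rw [(ithLargestEig_eq_of_strictAnti A r hanti hr0).2 i]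
  exact (hr i).trans_lt hhε

theorem lowerBidiagOf_mulVec {k : ℕ} (d : Fin k → ℝ) (e : Fin (k - 1) → ℝ) (v : Fin k → ℝ)
    (j : Fin k) : (lowerBidiagOf d e *ᵥ v) j =
      d j * v j + if h : 0 < (j : ℕ) then e ⟨j - 1, by omega⟩ * v ⟨j - 1, by omega⟩ else 0 := by
  rw [Matrix.mulVec, dotProduct, ← Finset.add_sum_erase _ _ (Finset.mem_univ j)]
  congr 1
  · simp [lowerBidiagOf]
  split_ifs with h
  · rw [Finset.sum_eq_single (⟨j - 1, by omega⟩ : Fin k)]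
    · simp only [lowerBidiagOf, Matrix.of_apply, Fin.ext_iff]
      rw [if_neg (by omega), dif_pos (by omega)]
    · intro b hb hne
      have hb := Finset.ne_of_mem_erase hb
      simp only [lowerBidiagOf, Matrix.of_apply]
      rw [if_neg hb.symm, dif_neg (by simp only [ne_eq, Fin.ext_iff] at hne; omega), zero_mul]
    · intro hn
      simp [Fin.ext_iff] at hn
      omega
  · refine Finset.sum_eq_zero fun b hb => ?_
    have hb := Finset.ne_of_mem_erase hb
    simp only [lowerBidiagOf, Matrix.of_apply]
    rw [if_neg hb.symm, dif_neg (by omega), zero_mul]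

theorem lowerBidiagOf_transpose_mulVec {k : ℕ} (d : Fin k → ℝ) (e : Fin (k - 1) → ℝ)
    (v : Fin k → ℝ) (j : Fin k) : ((lowerBidiagOf d e)ᵀ *ᵥ v) j =
      d j * v j + if h : (j : ℕ) + 1 < k then e ⟨j, by omega⟩ * v ⟨j + 1, h⟩ else 0 := by
  rw [Matrix.mulVec, dotProduct, ← Finset.add_sum_erase _ _ (Finset.mem_univ j)]
  congr 1
  · simp [lowerBidiagOf]
  split_ifs with h
  · rw [Finset.sum_eq_single (⟨j + 1, h⟩ : Fin k)]
    · simp only [lowerBidiagOf, Matrix.transpose_apply, Matrix.of_apply, Fin.ext_iff]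
      rw [if_neg (by omega), dif_pos trivial]
    · intro b hb hne
      have hb := Finset.ne_of_mem_erase hb
      simp only [lowerBidiagOf, Matrix.transpose_apply, Matrix.of_apply]
      rw [if_neg hb, dif_neg (by simp only [ne_eq, Fin.ext_iff] at hne; omega), zero_mul]
    · intro hn
      simp [Fin.ext_iff] at hn
  · refine Finset.sum_eq_zero fun b hb => ?_
    have hb := Finset.ne_of_mem_erase hb
    simp only [lowerBidiagOf, Matrix.transpose_apply, Matrix.of_apply]
    rw [if_neg hb, dif_neg (by omega), zero_mul]

theorem Lag_one_rec {γ : ℝ} (hγ : 0 < γ) (x : ℝ) :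
    √γ * Lag (γ - 1) 1 x = (x - γ) * Lag (γ - 1) 0 x := by
  have := (Real.sqrt_pos.2 hγ).ne'
  simp only [Lag, sub_add_cancel]
  field_simp

theorem Lag_add_two_rec {γ : ℝ} (hγ : 0 < γ) (n : ℕ) (x : ℝ) :
    √((n + 2) * (n + 1 + γ)) * Lag (γ - 1) (n + 2) x =
      (x - (2 * (n + 1) + γ)) * Lag (γ - 1) (n + 1) x -
        √((n + 1) * (n + γ)) * Lag (γ - 1) n x := by
  have h1 : ((n : ℝ) + 2) * (n + 2 + (γ - 1)) = (n + 2) * (n + 1 + γ) := by ring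
  have h2 : ((n : ℝ) + 1) * (n + 1 + (γ - 1)) = (n + 1) * (n + γ) := by ring
  have h3 : √(((n : ℝ) + 2) * (n + 1 + γ)) ≠ 0 := by positivity
  rw [Lag, h1, h2, mul_div_cancel₀ _ h3]
  ring

/-- A zero of the Laguerre polynomial is an eigenvalue of `BᵀB`, with eigenvector made of the
lower-degree Laguerre polynomials. -/
theorem lagB_transpose_mulVec_mulVec {k : ℕ} {γ : ℝ} (hγ : 0 < γ) {x : ℝ}
    (hx : Lag (γ - 1) k x = 0) :
    (lagB k γ)ᵀ *ᵥ (lagB k γ *ᵥ fun j : Fin k => Lag (γ - 1) (k - 1 - j) x) =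
      x • fun j : Fin k => Lag (γ - 1) (k - 1 - j) x := by
  have hB : (lagB k γ *ᵥ fun j : Fin k => Lag (γ - 1) (k - 1 - j) x) = fun j : Fin k =>
      √(γ + (k - 1 - (j : ℕ) : ℕ)) * Lag (γ - 1) (k - 1 - j) x +
        √((k - 1 - (j : ℕ) : ℕ) + 1) * Lag (γ - 1) (k - 1 - j + 1) x := by
    funext j
    have hj := j.isLt
    rw [lagB, lowerBidiagOf_mulVec]
    obtain ⟨n, hn⟩ : ∃ n, k = n + 1 + j := ⟨k - 1 - j, by omega⟩
    have hkj : k - 1 - (j : ℕ) = n := by omega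
    have hkr : (k : ℝ) = n + 1 + (j : ℕ) := by exact_mod_cast hn
    have hd : γ + (k : ℝ) - 1 - (j : ℕ) = γ + n := by rw [hkr]; ring
    rw [hkj, hd]
    congr 1
    split_ifs with h
    · have e1 : k - 1 - ((j : ℕ) - 1) = n + 1 := by omega
      have e2 : (k : ℝ) - 1 - ((j : ℕ) - 1 : ℕ) = n + 1 := by
        rw [hkr, Nat.cast_sub h]; push_cast; ring
      simp only [e1, e2]
    · have : n + 1 = k := by omega
      rw [this, hx, mul_zero]
  rw [hB]
  funext j
  have hj := j.isLt
  rw [lagB, lowerBidiagOf_transpose_mulVec]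
  obtain ⟨n, hn⟩ : ∃ n, k = n + 1 + j := ⟨k - 1 - j, by omega⟩
  have hkj : k - 1 - (j : ℕ) = n := by omega
  have hkr : (k : ℝ) = n + 1 + (j : ℕ) := by exact_mod_cast hn
  have hd : γ + (k : ℝ) - 1 - (j : ℕ) = γ + n := by rw [hkr]; ring
  have he : (k : ℝ) - 1 - (j : ℕ) = n := by rw [hkr]; ring
  simp only [Pi.smul_apply, smul_eq_mul, hkj, hd, he]
  rcases n with _ | n
  · have hs := Real.mul_self_sqrt hγ.le
    have := Lag_one_rec hγ x
    rw [dif_neg (by omega)]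
    simp only [Nat.cast_zero, add_zero, zero_add, Real.sqrt_one, one_mul]
    linear_combination this + Lag (γ - 1) 0 x * hs
  · have e1 : k - 1 - ((j : ℕ) + 1) = n := by omega
    have h0 := Lag_add_two_rec hγ n x
    rw [Real.sqrt_mul (by positivity), Real.sqrt_mul (by positivity)] at h0
    have s1 : √((n : ℝ) + 1 + γ) * √((n : ℝ) + 1 + γ) = n + 1 + γ :=
      Real.mul_self_sqrt (by positivity)
    have s2 : √((n : ℝ) + 1) * √((n : ℝ) + 1) = n + 1 := Real.mul_self_sqrt (by positivity)
    rw [dif_pos (by omega)]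
    simp only [e1]
    push_cast
    rw [show γ + ((n : ℝ) + 1) = n + 1 + γ by ring, show γ + (n : ℝ) = n + γ by ring,
      show (n : ℝ) + 1 + 1 = n + 2 by ring]
    linear_combination h0 + Lag (γ - 1) (n + 1) x * (s1 + s2)

theorem charpoly_smul_lagL_eval {k : ℕ} (hk : 1 ≤ k) {γ : ℝ} (hγ : 0 < γ) {x : ℝ}
    (hx : Lag (γ - 1) k x = 0) :
    (((k : ℝ)⁻¹) • lagL k γ).charpoly.eval (x / k) = 0 := by
  rw [lagL, ← Matrix.smul_mul, Matrix.charpoly_mul_comm, Matrix.eval_charpoly,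
    ← Matrix.exists_mulVec_eq_zero_iff]
  refine ⟨fun j : Fin k => Lag (γ - 1) (k - 1 - j) x, fun h => ?_, ?_⟩
  · have h0 := congrFun h ⟨k - 1, by omega⟩
    simp only [Nat.sub_self, Lag, sub_add_cancel, Pi.zero_apply] at h0
    exact (Real.rpow_pos_of_pos (Real.Gamma_pos_of_pos hγ) _).ne' h0
  · rw [Matrix.sub_mulVec, Matrix.mul_smul, Matrix.smul_mulVec, ← Matrix.mulVec_mulVec,
      lagB_transpose_mulVec_mulVec hγ hx, smul_smul, Matrix.scalar_apply]
    funext j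
    simp [div_eq_inv_mul]

/-- Integrand of the unnormalised chi moments. -/
def chiKernel (q x : ℝ) : ℝ := x ^ q * Real.exp (-x ^ 2 / 2)

theorem chiKernel_integrableOn {q : ℝ} (hq : -1 < q) : IntegrableOn (chiKernel q) (Set.Ioi 0) := by
  have := integrableOn_rpow_mul_exp_neg_mul_sq (b := 1 / 2) (by norm_num) hq
  refine this.congr_fun (fun x _ => ?_) measurableSet_Ioi
  simp only [chiKernel]
  congr 2
  ring

theorem integral_chiKernel {q : ℝ} (hq : -1 < q) :
    ∫ x in Set.Ioi 0, chiKernel q x = 2 ^ ((q - 1) / 2) * Real.Gamma ((q + 1) / 2) := by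
  have := integral_rpow_mul_exp_neg_mul_rpow (p := 2) (b := 1 / 2) (by norm_num) hq (by norm_num)
  have hpow : (2 : ℝ) ^ ((q - 1) / 2) = (1 / 2) ^ (-(q + 1) / 2) * (1 / 2) := by
    rw [one_div, Real.inv_rpow (by norm_num), ← Real.rpow_neg (by norm_num),
      show (q - 1) / 2 = -(-(q + 1) / 2) - 1 by ring, Real.rpow_sub_one (by norm_num)]
    ring
  rw [hpow, ← this]
  refine setIntegral_congr_fun measurableSet_Ioi fun x _ => ?_
  simp only [chiKernel, Real.rpow_two]
  congr 2
  ring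

/-- Normalising constant of the chi density. -/
def chiConst (r : ℝ) : ℝ := 2 ^ (1 - r / 2) / Real.Gamma (r / 2)

theorem chiConst_nonneg {r : ℝ} (hr : 0 < r) : 0 ≤ chiConst r :=
  div_nonneg (by positivity) (Real.Gamma_pos_of_pos (by positivity)).le

theorem chiConst_mul_integral_zero {r : ℝ} (hr : 0 < r) :
    chiConst r * ∫ x in Set.Ioi 0, chiKernel (r - 1) x = 1 := by
  have hG := (Real.Gamma_pos_of_pos (half_pos hr)).ne'
  rw [integral_chiKernel (by linarith), chiConst, sub_add_cancel, div_mul_eq_mul_div, ← mul_assoc,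
    ← Real.rpow_add (by norm_num), show 1 - r / 2 + (r - 1 - 1) / 2 = 0 by ring, Real.rpow_zero,
    one_mul, div_self hG]

theorem chiConst_mul_integral_two {r : ℝ} (hr : 0 < r) :
    chiConst r * ∫ x in Set.Ioi 0, chiKernel (r + 1) x = r := by
  have hG := (Real.Gamma_pos_of_pos (half_pos hr)).ne'
  rw [integral_chiKernel (by linarith), chiConst, div_mul_eq_mul_div, ← mul_assoc,
    ← Real.rpow_add (by norm_num), show 1 - r / 2 + (r + 1 - 1) / 2 = 1 by ring, Real.rpow_one,
    show (r + 1 + 1) / 2 = r / 2 + 1 by ring, Real.Gamma_add_one (by positivity)]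
  field_simp

theorem chiConst_mul_integral_four {r : ℝ} (hr : 0 < r) :
    chiConst r * ∫ x in Set.Ioi 0, chiKernel (r + 3) x = r * (r + 2) := by
  have hG := (Real.Gamma_pos_of_pos (half_pos hr)).ne'
  rw [integral_chiKernel (by linarith), chiConst, div_mul_eq_mul_div, ← mul_assoc,
    ← Real.rpow_add (by norm_num), show 1 - r / 2 + (r + 3 - 1) / 2 = 2 by ring, Real.rpow_two,
    show (r + 3 + 1) / 2 = r / 2 + 1 + 1 by ring, Real.Gamma_add_one (by positivity),
    Real.Gamma_add_one (by positivity)]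
  field_simp

theorem chiMeasure_eq (r : ℝ) : chiMeasure r =
    (volume.restrict (Set.Ioi 0)).withDensity fun x =>
      ENNReal.ofReal (chiConst r * chiKernel (r - 1) x) := by
  rw [← withDensity_indicator measurableSet_Ioi, chiMeasure]
  congr 1
  funext x
  by_cases hx : x ∈ Set.Ioi (0 : ℝ)
  · rw [Set.indicator_of_mem hx, Set.indicator_of_mem hx, chiConst, chiKernel]
    congr 1
    ring
  · rw [Set.indicator_of_notMem hx, Set.indicator_of_notMem hx, ENNReal.ofReal_zero]

theorem measurable_chiKernel (q : ℝ) : Measurable (chiKernel q) := by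
  unfold chiKernel
  fun_prop

theorem chiKernel_nonneg (q : ℝ) {x : ℝ} (hx : 0 < x) : 0 ≤ chiKernel q x := by
  unfold chiKernel
  positivity

theorem isProbabilityMeasure_chiMeasure {r : ℝ} (hr : 0 < r) :
    IsProbabilityMeasure (chiMeasure r) := by
  constructor
  rw [chiMeasure_eq, withDensity_apply _ MeasurableSet.univ, Measure.restrict_univ,
    ← ofReal_integral_eq_lintegral_ofReal ((chiKernel_integrableOn (by linarith)).const_mul _),
    integral_const_mul, chiConst_mul_integral_zero hr, ENNReal.ofReal_one]
  filter_upwards [ae_restrict_mem measurableSet_Ioi] with x hx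
  exact mul_nonneg (chiConst_nonneg hr) (chiKernel_nonneg _ hx)

theorem lintegral_chiMeasure_sq {r : ℝ} (hr : 0 < r) (b c : ℝ) :
    ∫⁻ x, ENNReal.ofReal ((x ^ 2 * b - c) ^ 2) ∂chiMeasure r =
      ENNReal.ofReal (r * (r + 2) * b ^ 2 - 2 * b * c * r + c ^ 2) := by
  have i0 := chiKernel_integrableOn (q := r - 1) (by linarith)
  have i2 := chiKernel_integrableOn (q := r + 1) (by linarith)
  have i4 := chiKernel_integrableOn (q := r + 3) (by linarith)
  have hsub : IntegrableOn (fun x => chiConst r * b ^ 2 * chiKernel (r + 3) x -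
      chiConst r * (2 * b * c) * chiKernel (r + 1) x) (Set.Ioi 0) :=
    (i4.const_mul _).sub (i2.const_mul _)
  have hint : IntegrableOn (fun x => (chiConst r * b ^ 2 * chiKernel (r + 3) x -
      chiConst r * (2 * b * c) * chiKernel (r + 1) x) +
      chiConst r * c ^ 2 * chiKernel (r - 1) x) (Set.Ioi 0) :=
    hsub.add (i0.const_mul _)
  have hval : r * (r + 2) * b ^ 2 - 2 * b * c * r + c ^ 2 =
      ∫ x in Set.Ioi 0, (chiConst r * b ^ 2 * chiKernel (r + 3) x -
        chiConst r * (2 * b * c) * chiKernel (r + 1) x) +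
        chiConst r * c ^ 2 * chiKernel (r - 1) x := by
    rw [integral_add hsub (i0.const_mul _),
      integral_sub (i4.const_mul _) (i2.const_mul _), integral_const_mul, integral_const_mul,
      integral_const_mul]
    linear_combination -b ^ 2 * chiConst_mul_integral_four hr +
      2 * b * c * chiConst_mul_integral_two hr - c ^ 2 * chiConst_mul_integral_zero hr
  have hexp (x : ℝ) (hx : 0 < x) : (chiConst r * b ^ 2 * chiKernel (r + 3) x -
        chiConst r * (2 * b * c) * chiKernel (r + 1) x) +
        chiConst r * c ^ 2 * chiKernel (r - 1) x =
      (chiConst r * chiKernel (r - 1) x) * (x ^ 2 * b - c) ^ 2 := by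
    have h4 : x ^ (r + 3) = x ^ (r - 1) * x ^ 4 := by
      rw [show r + 3 = r - 1 + (4 : ℕ) by push_cast; ring, Real.rpow_add_natCast hx.ne']
    have h2 : x ^ (r + 1) = x ^ (r - 1) * x ^ 2 := by
      rw [show r + 1 = r - 1 + (2 : ℕ) by push_cast; ring, Real.rpow_add_natCast hx.ne']
    simp only [chiKernel, h4, h2]
    ring
  have hk : Measurable fun x => ENNReal.ofReal (chiConst r * chiKernel (r - 1) x) :=
    ((measurable_chiKernel _).const_mul _).ennreal_ofReal
  rw [chiMeasure_eq, lintegral_withDensity_eq_lintegral_mul _ hk (by fun_prop), hval,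
    ofReal_integral_eq_lintegral_ofReal hint]
  · refine setLIntegral_congr_fun measurableSet_Ioi fun x hx => ?_
    simp only [Pi.mul_apply, hexp x hx]
    rw [ENNReal.ofReal_mul (mul_nonneg (chiConst_nonneg hr) (chiKernel_nonneg _ hx))]
  · filter_upwards [ae_restrict_mem measurableSet_Ioi] with x hx
    simp only [Pi.zero_apply, hexp x hx]
    exact mul_nonneg (mul_nonneg (chiConst_nonneg hr) (chiKernel_nonneg _ hx)) (sq_nonneg _)

theorem ae_pos_chiMeasure (r : ℝ) : ∀ᵐ x ∂chiMeasure r, 0 < x := by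
  rw [chiMeasure_eq]
  exact (withDensity_absolutelyContinuous _ _).ae_le (ae_restrict_mem measurableSet_Ioi)

/-- If `r β / β → c`, the scaled chi variable `χ_{r β} / √β` converges in probability to `√c`. -/
theorem tendsto_chiMeasure_abs_sub {r : ℝ → ℝ} {c : ℝ} (hr : ∀ β, 0 < β → 0 < r β)
    (hlim : Tendsto (fun β => r β / β) atTop (𝓝 c)) {δ : ℝ} (hδ : 0 < δ) :
    Tendsto (fun β => chiMeasure (r β) {x | δ ≤ |(√β)⁻¹ * x - √c|}) atTop (𝓝 0) := by
  have hc : 0 ≤ c := ge_of_tendsto hlim <| by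
    filter_upwards [eventually_gt_atTop 0] with β hβ
    exact (div_pos (hr β hβ) hβ).le
  set g : ℝ → ℝ := fun β =>
    r β * (r β + 2) * (β⁻¹) ^ 2 - 2 * β⁻¹ * c * r β + c ^ 2 with hg
  have hg0 : Tendsto g atTop (𝓝 0) := by
    have h := ((hlim.mul hlim).add ((hlim.mul tendsto_inv_atTop_zero).mul_const 2)).sub
      (hlim.const_mul (2 * c)) |>.add_const (c ^ 2)
    rw [show c * c + c * 0 * 2 - 2 * c * c + c ^ 2 = 0 by ring] at h
    refine h.congr fun β => ?_
    simp only [hg]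
    ring
  have hlim0 : Tendsto (fun β => ENNReal.ofReal (g β) / ENNReal.ofReal (δ ^ 4)) atTop (𝓝 0) := by
    have h := ENNReal.Tendsto.div_const (ENNReal.tendsto_ofReal hg0)
      (b := ENNReal.ofReal (δ ^ 4)) (Or.inr (by positivity))
    simpa using h
  refine tendsto_of_tendsto_of_tendsto_of_le_of_le' tendsto_const_nhds hlim0
    (Eventually.of_forall fun _ => zero_le) ?_
  filter_upwards [eventually_gt_atTop 0] with β hβ
  have hδ4 : ENNReal.ofReal (δ ^ 4) ≠ 0 := by positivity
  rw [ENNReal.le_div_iff_mul_le (Or.inl hδ4) (Or.inl ENNReal.ofReal_ne_top), mul_comm, hg,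
    ← lintegral_chiMeasure_sq (hr β hβ) β⁻¹ c]
  refine le_trans ?_ (mul_meas_ge_le_lintegral₀ (by fun_prop) (ENNReal.ofReal (δ ^ 4)))
  refine mul_le_mul' le_rfl (measure_mono_ae ?_)
  filter_upwards [ae_pos_chiMeasure (r β)] with x hx hmem
  refine ENNReal.ofReal_le_ofReal ?_
  change δ ≤ |(√β)⁻¹ * x - √c| at hmem
  have hfac : x ^ 2 * β⁻¹ - c = ((√β)⁻¹ * x - √c) * ((√β)⁻¹ * x + √c) := by
    have h1 := Real.sq_sqrt hβ.le
    have h2 := Real.sq_sqrt hc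
    have h3 : β⁻¹ = (√β)⁻¹ ^ 2 := by rw [inv_pow, h1]
    rw [h3]
    linear_combination h2
  have hy : 0 < (√β)⁻¹ * x := by positivity
  have hs := Real.sqrt_nonneg c
  have hsum : δ ≤ (√β)⁻¹ * x + √c := hmem.trans (abs_le.2 ⟨by linarith, by linarith⟩)
  have hsq : δ ^ 2 ≤ |x ^ 2 * β⁻¹ - c| := by
    rw [hfac, abs_mul, abs_of_pos (by linarith : 0 < (√β)⁻¹ * x + √c), sq]
    exact mul_le_mul hmem hsum hδ.le (abs_nonneg _)
  rw [← sq_abs (x ^ 2 * β⁻¹ - c), show δ ^ 4 = (δ ^ 2) ^ 2 by ring]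
  gcongr

theorem continuous_lowerBidiagOf {k : ℕ} :
    Continuous fun p : (Fin k → ℝ) × (Fin (k - 1) → ℝ) => lowerBidiagOf p.1 p.2 := by
  refine continuous_matrix fun i j => ?_
  simp only [lowerBidiagOf, Matrix.of_apply]
  split_ifs <;> fun_prop

theorem smul_lowerBidiagOf {k : ℕ} (t : ℝ) (d : Fin k → ℝ) (e : Fin (k - 1) → ℝ) :
    lowerBidiagOf (t • d) (t • e) = t • lowerBidiagOf d e := by
  ext i j
  simp only [lowerBidiagOf, Matrix.of_apply, Matrix.smul_apply, Pi.smul_apply]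
  split_ifs <;> simp

theorem prod_pi_setOf_exists_le {ι κ : Type*} [Fintype ι] [Fintype κ] (μ : ι → Measure ℝ)
    (ν : κ → Measure ℝ) [∀ i, IsProbabilityMeasure (μ i)] [∀ j, IsProbabilityMeasure (ν j)]
    (s : ι → Set ℝ) (t : κ → Set ℝ) (hs : ∀ i, MeasurableSet (s i)) (ht : ∀ j, MeasurableSet (t j)) :
    ((Measure.pi μ).prod (Measure.pi ν)) {p | (∃ i, p.1 i ∈ s i) ∨ ∃ j, p.2 j ∈ t j} ≤
      ∑ i, μ i (s i) + ∑ j, ν j (t j) := by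
  have hset : {p : (ι → ℝ) × (κ → ℝ) | (∃ i, p.1 i ∈ s i) ∨ ∃ j, p.2 j ∈ t j} =
      (⋃ i, (Function.eval i ∘ Prod.fst) ⁻¹' s i) ∪ ⋃ j, (Function.eval j ∘ Prod.snd) ⁻¹' t j := by
    ext p
    simp
  rw [hset]
  refine (measure_union_le _ _).trans (add_le_add ?_ ?_)
  · refine (measure_iUnion_fintype_le _ _).trans (Finset.sum_le_sum fun i _ => le_of_eq ?_)
    exact ((measurePreserving_eval μ i).comp measurePreserving_fst).measure_preimage
      (hs i).nullMeasurableSet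
  · refine (measure_iUnion_fintype_le _ _).trans (Finset.sum_le_sum fun j _ => le_of_eq ?_)
    exact ((measurePreserving_eval ν j).comp measurePreserving_snd).measure_preimage
      (ht j).nullMeasurableSet

/-- The scaled β-Laguerre matrix converges in probability to `lagL k γ / k`. -/
theorem tendsto_lagLaw_compl {k : ℕ} {γ : ℝ} {a : ℝ → ℝ}
    (ha₁ : ∀ β : ℝ, 0 < β → ((k : ℝ) - 1) * β / 2 < a β)
    (ha₂ : Tendsto (fun β => a β / β) atTop (𝓝 (((k : ℝ) + γ - 1) / 2)))
    {U : Set (Matrix (Fin k) (Fin k) ℝ)} (hU : U ∈ 𝓝 ((k : ℝ)⁻¹ • lagL k γ)) :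
    Tendsto (fun β => lagLaw k β (a β) Uᶜ) atTop (𝓝 0) := by
  have : BorelSpace (Matrix (Fin k) (Fin k) ℝ) := inferInstanceAs (BorelSpace (Fin k → Fin k → ℝ))
  set d₀ : Fin k → ℝ := fun j => √(γ + (k : ℝ) - 1 - (j : ℕ)) with hd₀
  set e₀ : Fin (k - 1) → ℝ := fun j => √((k : ℝ) - 1 - (j : ℕ)) with he₀
  set G : (Fin k → ℝ) × (Fin (k - 1) → ℝ) → Matrix (Fin k) (Fin k) ℝ := fun p =>
    (k : ℝ)⁻¹ • (lowerBidiagOf p.1 p.2 * (lowerBidiagOf p.1 p.2)ᵀ) with hG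
  have hGc : Continuous G := Continuous.fun_const_smul
    (continuous_lowerBidiagOf.matrix_mul continuous_lowerBidiagOf.matrix_transpose) _
  have hGU : G ⁻¹' interior U ∈ 𝓝 (d₀, e₀) :=
    hGc.continuousAt.preimage_mem_nhds (interior_mem_nhds.2 hU)
  obtain ⟨δ, hδ, hball⟩ := Metric.mem_nhds_iff.1 hGU
  have hscale (β : ℝ) (hβ : 0 < β) (p : (Fin k → ℝ) × (Fin (k - 1) → ℝ)) :
      ((k : ℝ) * β)⁻¹ • (lowerBidiagOf p.1 p.2 * (lowerBidiagOf p.1 p.2)ᵀ) = G ((√β)⁻¹ • p) := by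
    simp only [hG, Prod.smul_fst, Prod.smul_snd, smul_lowerBidiagOf, Matrix.transpose_smul,
      Matrix.smul_mul, Matrix.mul_smul, smul_smul]
    congr 1
    rw [← mul_inv (√β), Real.mul_self_sqrt hβ.le, mul_inv]
  have hd_pos (j : Fin k) (β : ℝ) (hβ : 0 < β) : 0 < 2 * a β - β * (j : ℕ) := by
    have h1 := ha₁ β hβ
    have h2 : ((j : ℕ) : ℝ) ≤ k - 1 := by
      have : ((j : ℕ) : ℝ) + 1 ≤ k := by exact_mod_cast j.isLt
      linarith
    nlinarith [mul_le_mul_of_nonneg_left h2 hβ.le]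
  have hd (j : Fin k) : Tendsto (fun β => chiMeasure (2 * a β - β * (j : ℕ))
      {x | δ ≤ |(√β)⁻¹ * x - d₀ j|}) atTop (𝓝 0) := by
    refine tendsto_chiMeasure_abs_sub (hd_pos j) ?_ hδ
    have h := (ha₂.const_mul 2).sub_const ((j : ℕ) : ℝ)
    rw [show 2 * (((k : ℝ) + γ - 1) / 2) - (j : ℕ) = γ + k - 1 - (j : ℕ) by ring] at h
    refine h.congr' ?_
    filter_upwards [eventually_gt_atTop 0] with β hβ
    field_simp
  have he_pos (j : Fin (k - 1)) : 0 < (k : ℝ) - 1 - (j : ℕ) := by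
    have : ((j : ℕ) : ℝ) + 1 + 1 ≤ k := by
      have := j.isLt
      exact_mod_cast (by omega : (j : ℕ) + 1 + 1 ≤ k)
    linarith
  have he (j : Fin (k - 1)) : Tendsto (fun β => chiMeasure (β * ((k : ℝ) - 1 - (j : ℕ)))
      {x | δ ≤ |(√β)⁻¹ * x - e₀ j|}) atTop (𝓝 0) := by
    refine tendsto_chiMeasure_abs_sub (fun β hβ => mul_pos hβ (he_pos j)) ?_ hδ
    refine tendsto_const_nhds.congr' ?_
    filter_upwards [eventually_gt_atTop 0] with β hβ
    field_simp
  have hsum := (tendsto_finsetSum Finset.univ fun j _ => hd j).add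
    (tendsto_finsetSum Finset.univ fun j _ => he j)
  simp only [Finset.sum_const_zero, add_zero] at hsum
  refine tendsto_of_tendsto_of_tendsto_of_le_of_le' tendsto_const_nhds hsum
    (Eventually.of_forall fun _ => zero_le) ?_
  filter_upwards [eventually_gt_atTop 0] with β hβ
  have hpd (j : Fin k) : IsProbabilityMeasure (chiMeasure (2 * a β - β * (j : ℕ))) :=
    isProbabilityMeasure_chiMeasure (hd_pos j β hβ)
  have hpe (j : Fin (k - 1)) : IsProbabilityMeasure (chiMeasure (β * ((k : ℝ) - 1 - (j : ℕ)))) :=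
    isProbabilityMeasure_chiMeasure (mul_pos hβ (he_pos j))
  have hmeas : Measurable fun p : (Fin k → ℝ) × (Fin (k - 1) → ℝ) =>
      ((k : ℝ) * β)⁻¹ • (lowerBidiagOf p.1 p.2 * (lowerBidiagOf p.1 p.2)ᵀ) := by
    simp only [hscale β hβ]
    exact (hGc.comp (continuous_const_smul _)).measurable
  calc lagLaw k β (a β) Uᶜ ≤ lagLaw k β (a β) (interior U)ᶜ :=
        measure_mono (Set.compl_subset_compl.2 interior_subset)
    _ ≤ _ := by
        rw [lagLaw, Measure.map_apply hmeas isOpen_interior.measurableSet.compl]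
        refine (measure_mono fun p hp => ?_).trans (prod_pi_setOf_exists_le _ _
          (fun j => {x | δ ≤ |(√β)⁻¹ * x - d₀ j|}) (fun j => {x | δ ≤ |(√β)⁻¹ * x - e₀ j|})
          (fun j => measurableSet_le measurable_const (by fun_prop))
          fun j => measurableSet_le measurable_const (by fun_prop))
        by_contra hnot
        simp only [Set.mem_ofPred_eq, not_or, not_exists, not_le] at hnot
        refine hp ?_
        change _ • _ ∈ interior U
        rw [hscale β hβ]
        refine hball (?_ : (√β)⁻¹ • p ∈ Metric.ball (d₀, e₀) δ)
        rw [Metric.mem_ball, Prod.dist_eq, max_lt_iff, dist_pi_lt_iff hδ, dist_pi_lt_iff hδ]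
        exact hnot

theorem laguerre_eig_tendsto_root (k : ℕ) (hk : 1 ≤ k) (γ : ℝ) (hγ : 0 < γ)
    (a : ℝ → ℝ) (ha₁ : ∀ β : ℝ, 0 < β → ((k:ℝ) - 1) * β / 2 < a β)
    (ha₂ : Tendsto (fun β => a β / β) atTop (𝓝 (((k:ℝ) + γ - 1) / 2)))
    (l : Fin k → ℝ) (hanti : StrictAnti l) (hroot : ∀ i, Lag (γ - 1) k (l i) = 0)
    (i : Fin k) (ε : ℝ) (hε : 0 < ε) :
    Tendsto (fun β : ℝ =>
        lagLaw k β (a β) {A | ε < |ithLargestEig A i - l i / (k:ℝ)|})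
      atTop (𝓝 0) := by
  have hanti' : StrictAnti fun j => l j / (k : ℝ) := fun i j hij =>
    div_lt_div_of_pos_right (hanti hij) (by exact_mod_cast hk)
  have hnear := eventually_ithLargestEig_near ((k : ℝ)⁻¹ • lagL k γ) _ hanti'
    (fun j => charpoly_smul_lagL_eval hk hγ (hroot j)) hε
  refine tendsto_of_tendsto_of_tendsto_of_le_of_le tendsto_const_nhds
    (tendsto_lagLaw_compl ha₁ ha₂ hnear) (fun _ => zero_le) fun β => measure_mono ?_
  intro A hA hall
  exact lt_asymm hA (hall i)

end
end

section
/- Let Z be the random k×k lower bidiagonal matrix whose diagonal and subdiagonal entries are i.i.d. N(0,1), all mutually independent, and let B be any deterministic k×k real matrix. Then for any deterministic vectors v, w ∈ ℝ^k, the pair (v^T(B Z^T + Z B^T)v, w^T(B Z^T + Z B^T)w) is a centered jointly Gaussian vector with covariance 4·[ Σ_{p=1}^{k} v_p (B^T v)_p w_p (B^T w)_p + Σ_{p=2}^{k} v_p (B^T v)_{p−1} w_p (B^T w)_{p−1} ]; in particular v^T(B Z^T + Z B^T)v = 2 v^T Z B^T v is a centered Gaussian random variable. -/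
open MeasureTheory ProbabilityTheory Filter Polynomial Matrix Topology Asymptotics

noncomputable section

/-- Covariance of the quadratic forms `vᵀ(BZᵀ+ZBᵀ)v`, `wᵀ(BZᵀ+ZBᵀ)w` in the lower
bidiagonal Gaussian matrix `Z`. -/
def bidQuadCov {k : ℕ} (B : Matrix (Fin k) (Fin k) ℝ) (v w : Fin k → ℝ) : ℝ :=
  4 * ((∑ p : Fin k, v p * Bᵀ.mulVec v p * w p * Bᵀ.mulVec w p) +
    ∑ p : Fin (k-1), v (finR p) * Bᵀ.mulVec v (finL p) * w (finR p) * Bᵀ.mulVec w (finL p))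

lemma lowerBidiagOf_apply_eq_add_sum {k : ℕ} (d : Fin k → ℝ) (e : Fin (k - 1) → ℝ)
    (i j : Fin k) :
    lowerBidiagOf d e i j =
      (if i = j then d i else 0) + ∑ l, if i = finR l ∧ j = finL l then e l else 0 := by
  unfold lowerBidiagOf
  rw [Matrix.of_apply]
  split_ifs with hij hji
  · rw [Finset.sum_eq_zero, add_zero]
    rintro l -
    refine if_neg ?_
    rintro ⟨h₁, h₂⟩
    simp only [Fin.ext_iff, finL, finR] at hij h₁ h₂
    omega
  · rw [Finset.sum_eq_single ⟨j, by have := i.isLt; omega⟩, if_pos, zero_add]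
    · exact ⟨Fin.ext hji.symm, rfl⟩
    · rintro l - hl
      refine if_neg fun h ↦ hl ?_
      simp [h.2, finL]
    · simp
  · rw [Finset.sum_eq_zero, add_zero]
    rintro l -
    refine if_neg ?_
    rintro ⟨rfl, rfl⟩
    exact hji rfl

lemma dotProduct_lowerBidiagOf_mulVec {k : ℕ} (d : Fin k → ℝ) (e : Fin (k - 1) → ℝ)
    (x y : Fin k → ℝ) :
    x ⬝ᵥ lowerBidiagOf d e *ᵥ y =
      (∑ p, x p * y p * d p) + ∑ l, x (finR l) * y (finL l) * e l := by
  simp only [dotProduct, mulVec, lowerBidiagOf_apply_eq_add_sum, add_mul, Finset.sum_add_distrib,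
    mul_add, Finset.sum_mul, Finset.mul_sum]
  congr 1
  · simp [mul_assoc, mul_comm (d _)]
  · rw [Finset.sum_congr rfl fun i _ ↦ Finset.sum_comm, Finset.sum_comm]
    refine Finset.sum_congr rfl fun l _ ↦ ?_
    simp only [ite_and, ite_mul, zero_mul, mul_ite, mul_zero, Finset.sum_ite_eq',
      Finset.sum_ite_irrel, Finset.sum_const_zero, Finset.mem_univ, if_true]
    ring

lemma dotProduct_mul_transpose_add_mulVec {k : ℕ} (B M : Matrix (Fin k) (Fin k) ℝ)
    (v : Fin k → ℝ) :
    v ⬝ᵥ (B * Mᵀ + M * Bᵀ).mulVec v = 2 * (v ⬝ᵥ (M * Bᵀ).mulVec v) := by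
  have h : v ⬝ᵥ (B * Mᵀ) *ᵥ v = v ⬝ᵥ (M * Bᵀ) *ᵥ v := by
    rw [← dotProduct_transpose_mulVec, transpose_mul, transpose_transpose]
  rw [add_mulVec, dotProduct_add, h, two_mul]

lemma map_sum_mul_pi_gaussianReal {ι : Type*} [Fintype ι] (a : ι → ℝ) :
    (Measure.pi fun _ : ι ↦ gaussianReal 0 1).map (fun x ↦ ∑ i, a i * x i) =
      gaussianReal 0 (∑ i, a i ^ 2).toNNReal := by
  set L := innerSL ℝ (WithLp.toLp 2 a)
  have h : (fun x : ι → ℝ ↦ ∑ i, a i * x i) = L ∘ WithLp.toLp 2 := by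
    ext x
    simp [L, PiLp.inner_apply, mul_comm]
  rw [h, ← Measure.map_map (by fun_prop) (by fun_prop), map_pi_eq_stdGaussian,
    IsGaussian.map_eq_gaussianReal, integral_strongDual_stdGaussian, variance_dual_stdGaussian,
    innerSL_apply_norm, EuclideanSpace.real_norm_sq_eq]

lemma map_sum_mul_add_sum_mul_gaussianReal {ι κ : Type*} [Fintype ι] [Fintype κ]
    (a : ι → ℝ) (b : κ → ℝ) :
    ((Measure.pi fun _ : ι ↦ gaussianReal 0 1).prod
        (Measure.pi fun _ : κ ↦ gaussianReal 0 1)).map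
        (fun p ↦ (∑ i, a i * p.1 i) + ∑ j, b j * p.2 j) =
      gaussianReal 0 ((∑ i, a i ^ 2) + ∑ j, b j ^ 2).toNNReal := by
  have h : (fun p : (ι → ℝ) × (κ → ℝ) ↦ (∑ i, a i * p.1 i) + ∑ j, b j * p.2 j) =
      (fun q : ℝ × ℝ ↦ q.1 + q.2) ∘
        Prod.map (fun x ↦ ∑ i, a i * x i) (fun y ↦ ∑ j, b j * y j) := rfl
  rw [h, ← Measure.map_map (by fun_prop) (by fun_prop),
    ← Measure.map_prod_map _ _ (by fun_prop) (by fun_prop), map_sum_mul_pi_gaussianReal,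
    map_sum_mul_pi_gaussianReal, ← Measure.conv, gaussianReal_conv_gaussianReal, add_zero,
    Real.toNNReal_add (by positivity) (by positivity)]

lemma measurable_lowerBidiagOf {k : ℕ} :
    Measurable fun p : (Fin k → ℝ) × (Fin (k - 1) → ℝ) ↦ lowerBidiagOf p.1 p.2 := by
  refine measurable_pi_iff.2 fun i ↦ measurable_pi_iff.2 fun j ↦ ?_
  simp only [lowerBidiagOf_apply_eq_add_sum]
  refine .add ?_ (Finset.measurable_sum _ fun l _ ↦ ?_) <;> split_ifs <;> fun_prop

instance isProbabilityMeasure_zBidLaw (k : ℕ) : IsProbabilityMeasure (zBidLaw k) :=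
  Measure.isProbabilityMeasure_map measurable_lowerBidiagOf.aemeasurable

lemma measurable_dotProduct_mul_transpose_add_mulVec {k : ℕ} (B : Matrix (Fin k) (Fin k) ℝ)
    (v : Fin k → ℝ) :
    Measurable fun M : Matrix (Fin k) (Fin k) ℝ ↦ v ⬝ᵥ (B * Mᵀ + M * Bᵀ).mulVec v := by
  have h (i j : Fin k) : Measurable fun M : Matrix (Fin k) (Fin k) ℝ ↦ M i j :=
    (measurable_pi_apply j).comp (measurable_pi_apply i)
  simp_rw [dotProduct_mul_transpose_add_mulVec, ← mulVec_mulVec]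
  refine .const_mul (Finset.measurable_sum _ fun i _ ↦ .const_mul ?_ _) _
  change Measurable fun M : Matrix (Fin k) (Fin k) ℝ ↦ ∑ j, M i j * (Bᵀ *ᵥ v) j
  exact Finset.measurable_sum _ fun j _ ↦ (h i j).mul_const _

lemma bidQuadCov_comm {k : ℕ} (B : Matrix (Fin k) (Fin k) ℝ) (v w : Fin k → ℝ) :
    bidQuadCov B v w = bidQuadCov B w v := by
  unfold bidQuadCov
  congr 2 <;> exact Finset.sum_congr rfl fun _ _ ↦ by ring

lemma map_linear_combination_zBidLaw {k : ℕ} (B : Matrix (Fin k) (Fin k) ℝ) (v w : Fin k → ℝ)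
    (s t : ℝ) :
    (zBidLaw k).map (fun M ↦ s * (v ⬝ᵥ (B * Mᵀ + M * Bᵀ).mulVec v) +
        t * (w ⬝ᵥ (B * Mᵀ + M * Bᵀ).mulVec w)) =
      gaussianReal 0 (s ^ 2 * bidQuadCov B v v + s * t * bidQuadCov B v w +
        t * s * bidQuadCov B w v + t ^ 2 * bidQuadCov B w w).toNNReal := by
  have hm := fun u ↦ measurable_dotProduct_mul_transpose_add_mulVec B u
  rw [zBidLaw, Measure.map_map (((hm v).const_mul s).fun_add ((hm w).const_mul t))
    measurable_lowerBidiagOf]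
  convert map_sum_mul_add_sum_mul_gaussianReal
    (fun p ↦ 2 * (s * (v p * (Bᵀ *ᵥ v) p) + t * (w p * (Bᵀ *ᵥ w) p)))
    (fun l : Fin (k - 1) ↦ 2 * (s * (v (finR l) * (Bᵀ *ᵥ v) (finL l)) +
      t * (w (finR l) * (Bᵀ *ᵥ w) (finL l)))) using 2
  · ext p
    simp only [Function.comp_apply, dotProduct_mul_transpose_add_mulVec, ← mulVec_mulVec,
      dotProduct_lowerBidiagOf_mulVec, mul_add, add_mul, mul_assoc, Finset.sum_add_distrib,
      ← Finset.mul_sum]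
    ring
  · congr 1
    rw [bidQuadCov_comm B w v]
    simp only [bidQuadCov]
    have key {ι : Type} [Fintype ι] (x y : ι → ℝ) :
        ∑ i, (2 * (s * x i + t * y i)) ^ 2 = 4 * (s ^ 2 * ∑ i, x i * x i +
          2 * s * t * ∑ i, x i * y i + t ^ 2 * ∑ i, y i * y i) := by
      simp only [Finset.mul_sum, ← Finset.sum_add_distrib]
      exact Finset.sum_congr rfl fun _ _ ↦ by ring
    rw [key, key]
    simp only [← mul_assoc]
    ring

theorem bidiagonal_quadratic_forms_gaussian (k : ℕ)
    (B : Matrix (Fin k) (Fin k) ℝ) (v w : Fin k → ℝ) :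
    (∀ M : Matrix (Fin k) (Fin k) ℝ,
      v ⬝ᵥ (B * Mᵀ + M * Bᵀ).mulVec v = 2 * (v ⬝ᵥ (M * Bᵀ).mulVec v)) ∧
    IsCenteredGaussianVec
      (Measure.map (fun M : Matrix (Fin k) (Fin k) ℝ =>
        ![v ⬝ᵥ (B * Mᵀ + M * Bᵀ).mulVec v, w ⬝ᵥ (B * Mᵀ + M * Bᵀ).mulVec w]) (zBidLaw k))
      ![![bidQuadCov B v v, bidQuadCov B v w], ![bidQuadCov B w v, bidQuadCov B w w]] ∧
    Measure.map (fun M : Matrix (Fin k) (Fin k) ℝ =>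
        v ⬝ᵥ (B * Mᵀ + M * Bᵀ).mulVec v) (zBidLaw k)
      = gaussianReal 0 (bidQuadCov B v v).toNNReal := by
  have hm := fun u ↦ measurable_dotProduct_mul_transpose_add_mulVec B u
  have hpair : Measurable fun M : Matrix (Fin k) (Fin k) ℝ ↦
      ![v ⬝ᵥ (B * Mᵀ + M * Bᵀ).mulVec v, w ⬝ᵥ (B * Mᵀ + M * Bᵀ).mulVec w] :=
    measurable_pi_iff.2 (Fin.forall_fin_two.2 ⟨hm v, hm w⟩)
  refine ⟨fun M ↦ dotProduct_mul_transpose_add_mulVec B M v,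
    ⟨Measure.isProbabilityMeasure_map hpair.aemeasurable, fun c ↦ ?_⟩, ?_⟩
  · rw [Measure.map_map (by fun_prop) hpair]
    convert map_linear_combination_zBidLaw B v w (c 0) (c 1) using 2
    · ext M
      simp [Fin.sum_univ_two]
    · simp only [Fin.sum_univ_two, cons_val_zero, cons_val_one]
      ring_nf
  · simpa using map_linear_combination_zBidLaw B v w 1 0

end
end

section
/- Fix 1 ≤ i ≤ k, and let v_i ∈ ℝ^k be the vector with components (v_i)_j = H_{k−j}(h_i^{(k)}), j = 1,…,k. As β → ∞, the random variable √β·(λ_i(A_β) − h_i^{(k)}/√(2k)) converges in distribution to (1/√(2k))·(v_i^T Z v_i)/(v_i^T v_i) = (1/√(2k))·[ Σ_{l=0}^{k−1} H_l²(h_i^{(k)})·M_l + 2·Σ_{l=1}^{k−1} H_l(h_i^{(k)})·H_{l−1}(h_i^{(k)})·N_l ] / Σ_{l=0}^{k−1} H_l²(h_i^{(k)}), where the M_l are i.i.d. N(0,1), the N_l are i.i.d. N(0,1/4), and all of these variables are mutually independent; in particular this limit is a centered Gaussian random variable of variance (1/(2k))·[ Σ_{l=0}^{k−1} H_l⁴(h_i^{(k)})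 + Σ_{l=0}^{k−2} H_{l+1}²(h_i^{(k)})·H_l²(h_i^{(k)}) ] / (Σ_{l=0}^{k−1} H_l²(h_i^{(k)}))². -/
open MeasureTheory ProbabilityTheory Filter Polynomial Matrix Topology Asymptotics

noncomputable section

/-- Variance of the limiting Gaussian fluctuation of a single eigenvalue (β-Hermite case). -/
def hermVar (k : ℕ) (h : Fin k → ℝ) (i : Fin k) : ℝ :=
  ((∑ l ∈ Finset.range k, (Hpoly l (h i))^4) +
    ∑ l ∈ Finset.range (k-1), (Hpoly (l+1) (h i))^2 * (Hpoly l (h i))^2) /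
  (∑ l ∈ Finset.range k, (Hpoly l (h i))^2)^2

/-- The limiting law of the fluctuation of the `i`-th eigenvalue in the β-Hermite model:
the law of `(1/√(2k))·(vᵢᵀ Z vᵢ)/(vᵢᵀ vᵢ)` where `(vᵢ)_j = H_(k-j)(h i)`. -/
def hermFlucLimit (k : ℕ) (h : Fin k → ℝ) (i : Fin k) : Measure ℝ :=
  Measure.map (fun M : Matrix (Fin k) (Fin k) ℝ =>
      (Real.sqrt (2 * (k:ℝ)))⁻¹ *
        ((fun j : Fin k => Hpoly (k - 1 - (j:ℕ)) (h i)) ⬝ᵥ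
          M.mulVec (fun j : Fin k => Hpoly (k - 1 - (j:ℕ)) (h i))) /
        ((fun j : Fin k => Hpoly (k - 1 - (j:ℕ)) (h i)) ⬝ᵥ
          (fun j : Fin k => Hpoly (k - 1 - (j:ℕ)) (h i))))
    (zLaw k)

lemma ithLargestEig_eq_of_charpoly_eq_prod {n : ℕ} {M : Matrix (Fin n) (Fin n) ℝ} {μ : Fin n → ℝ}
    (hμ : Antitone μ) (hM : M.charpoly = ∏ j, (X - C (μ j))) (i : Fin n) :
    ithLargestEig M i = μ i := by
  have hroots : M.charpoly.roots = Multiset.map μ Finset.univ.val := by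
    rw [hM, Polynomial.roots_prod]
    · simp
    · simp [Finset.prod_ne_zero_iff, Polynomial.X_sub_C_ne_zero]
  have hrev : Multiset.map μ Finset.univ.val = ((List.ofFn (μ ∘ Fin.rev) : List ℝ) : Multiset ℝ) := by
    rw [← Fin.univ_val_map, ← Multiset.map_map]
    congr 1
    exact (congrArg Finset.val (Finset.map_univ_equiv (Fin.revPerm (n := n)))).symm
  have hsort : M.charpoly.roots.sort (· ≤ ·) = List.ofFn (μ ∘ Fin.rev) := by
    rw [hroots, hrev, Multiset.coe_sort]
    apply List.mergeSort_of_pairwise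
    simp_rw [decide_eq_true_eq, ← List.sortedLE_iff_pairwise]
    exact (hμ.comp Fin.rev_anti).sortedLE_ofFn
  have hi := i.isLt
  rw [ithLargestEig, hsort, List.getD_eq_getElem _ _ (by simp; omega)]
  simp only [List.getElem_ofFn, Function.comp_apply]
  congr 1
  ext
  simp [Fin.rev]
  omega

lemma antitone_ithLargestEig_and_charpoly_eq {n : ℕ} {A : Matrix (Fin n) (Fin n) ℝ}
    (hA : A.IsHermitian) :
    Antitone (ithLargestEig A) ∧ A.charpoly = ∏ j, (X - C (ithLargestEig A j)) := by
  have hn : n = Fintype.card (Fin n) := (Fintype.card_fin n).symm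
  set μ : Fin n → ℝ := fun j => hA.eigenvalues₀ (Fin.cast hn j) with hμdef
  have hμ : Antitone μ := fun a b hab => hA.eigenvalues₀_antitone (by simpa using hab)
  have hch : A.charpoly = ∏ j, (X - C (μ j)) := by
    rw [hA.charpoly_eq]
    let e : Fin n ≃ Fin n :=
      (finCongr hn).trans (Fintype.equivOfCardEq (Fintype.card_fin _))
    rw [← e.prod_comp]
    refine Finset.prod_congr rfl fun j _ => ?_
    simp [IsHermitian.eigenvalues, e, hμdef]
  have heq : ithLargestEig A = μ := funext fun i => ithLargestEig_eq_of_charpoly_eq_prod hμ hch i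
  rw [heq]
  exact ⟨hμ, hch⟩

lemma exists_ithLargestEig_eq_eigenvalues {n : ℕ} {A : Matrix (Fin n) (Fin n) ℝ}
    (hA : A.IsHermitian) (i : Fin n) : ∃ j, ithLargestEig A j = hA.eigenvalues i := by
  have h1 := congrArg (Polynomial.eval (hA.eigenvalues i)) (antitone_ithLargestEig_and_charpoly_eq hA).2
  rw [hA.charpoly_eq, Polynomial.eval_prod, Polynomial.eval_prod,
    Finset.prod_eq_zero (Finset.mem_univ i) (by simp)] at h1
  obtain ⟨j, -, hj⟩ := Finset.prod_eq_zero_iff.1 h1.symm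
  exact ⟨j, by simp at hj; linarith⟩

lemma exists_ithLargestEig_near {n : ℕ} {A : Matrix (Fin n) (Fin n) ℝ} (hA : A.IsHermitian)
    {w : Fin n → ℝ} (hw : w ≠ 0) (m : ℝ) :
    ∃ j, (ithLargestEig A j - m) ^ 2 * (w ⬝ᵥ w) ≤ (A *ᵥ w - m • w) ⬝ᵥ (A *ᵥ w - m • w) := by
  by_contra! hcon
  set b := hA.eigenvectorBasis
  have hparse : ∀ x : Fin n → ℝ, x ⬝ᵥ x = ∑ j, (x ⬝ᵥ ⇑(b j)) ^ 2 := by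
    intro x
    have := b.sum_sq_norm_inner_left (WithLp.toLp 2 x)
    rw [EuclideanSpace.norm_sq_eq] at this
    simp only [Real.norm_eq_abs, sq_abs] at this
    simp only [dotProduct, ← sq]
    rw [← this]
    refine Finset.sum_congr rfl fun j _ => ?_
    simp [PiLp.inner_apply, mul_comm]
  have hres : ∀ j, (A *ᵥ w - m • w) ⬝ᵥ ⇑(b j) = (hA.eigenvalues j - m) * (w ⬝ᵥ ⇑(b j)) := by
    intro j
    have hsymm : (A *ᵥ w) ⬝ᵥ ⇑(b j) = w ⬝ᵥ (A *ᵥ ⇑(b j)) := by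
      have hT : Aᵀ = A := by simpa [IsSymm] using hA
      rw [Matrix.dotProduct_mulVec, ← Matrix.mulVec_transpose, hT]
    rw [sub_dotProduct, hsymm, hA.mulVec_eigenvectorBasis, dotProduct_smul, smul_dotProduct]
    simp [b]; ring
  have hlt : ∀ j, (A *ᵥ w - m • w) ⬝ᵥ (A *ᵥ w - m • w) < (hA.eigenvalues j - m) ^ 2 * (w ⬝ᵥ w) := by
    intro j
    obtain ⟨l, hl⟩ := exists_ithLargestEig_eq_eigenvalues hA j
    rw [← hl]; exact hcon l
  have hn : Nonempty (Fin n) := by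
    by_contra hne
    rw [not_nonempty_iff] at hne
    exact hw (Subsingleton.elim _ _)
  obtain ⟨j₀, hj₀⟩ := Finite.exists_min fun j => (hA.eigenvalues j - m) ^ 2
  have h1 := hlt j₀
  rw [hparse (A *ᵥ w - m • w), hparse w, Finset.mul_sum] at h1
  refine absurd h1 (not_lt.2 (Finset.sum_le_sum fun j _ => ?_))
  rw [hres, mul_pow]
  exact mul_le_mul_of_nonneg_right (hj₀ j) (sq_nonneg _)

lemma exists_eigenvalues_eq_ithLargestEig {n : ℕ} {A : Matrix (Fin n) (Fin n) ℝ}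
    (hA : A.IsHermitian) (i : Fin n) : ∃ j, hA.eigenvalues j = ithLargestEig A i := by
  have h1 := congrArg (Polynomial.eval (ithLargestEig A i)) (antitone_ithLargestEig_and_charpoly_eq hA).2
  rw [hA.charpoly_eq, Polynomial.eval_prod, Polynomial.eval_prod,
    Finset.prod_eq_zero (s := Finset.univ) (f := fun j => eval _ (X - C (ithLargestEig A j)))
      (Finset.mem_univ i) (by simp)] at h1
  obtain ⟨j, -, hj⟩ := Finset.prod_eq_zero_iff.1 h1
  exact ⟨j, by simp at hj; linarith⟩

lemma sq_ithLargestEig_le {n : ℕ} {A : Matrix (Fin n) (Fin n) ℝ} (hA : A.IsHermitian)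
    (i : Fin n) : ithLargestEig A i ^ 2 ≤ ∑ a, ∑ c, A a c ^ 2 := by
  obtain ⟨j, hj⟩ := exists_eigenvalues_eq_ithLargestEig hA i
  rw [← hj]
  set w : Fin n → ℝ := ⇑(hA.eigenvectorBasis j)
  have hw : ∑ c, w c ^ 2 = 1 := by
    have h := hA.eigenvectorBasis.orthonormal.1 j
    have h2 := EuclideanSpace.norm_sq_eq (hA.eigenvectorBasis j)
    rw [h] at h2
    simpa using h2.symm
  have hAw : A *ᵥ w = hA.eigenvalues j • w := hA.mulVec_eigenvectorBasis j
  calc hA.eigenvalues j ^ 2 = ∑ a, (A *ᵥ w) a ^ 2 := by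
        simp [hAw, mul_pow, ← Finset.mul_sum, hw]
    _ ≤ ∑ a, (∑ c, A a c ^ 2) * ∑ c, w c ^ 2 :=
        Finset.sum_le_sum fun a _ => by
          simpa only [mulVec, dotProduct] using
            Finset.sum_mul_sq_le_sq_mul_sq Finset.univ (fun c => A a c) w
    _ = _ := by simp [hw]

lemma continuous_ithLargestEig_comp {T : Type*} [TopologicalSpace T] {n : ℕ}
    {M : T → Matrix (Fin n) (Fin n) ℝ} (hM : Continuous M) (hsymm : ∀ t, (M t).IsHermitian) :
    Continuous fun t => ithLargestEig (M t) := by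
  rw [continuous_iff_continuousAt]
  intro t
  set S : T → ℝ := fun s => ∑ a, ∑ c, M s a c ^ 2
  have hS : Continuous S := by fun_prop
  refine (isCompact_closedBall (0 : Fin n → ℝ) (S t + 2)).tendsto_nhds_of_unique_mapClusterPt ?_ ?_
  · filter_upwards [hS.continuousAt.eventually_lt_const (lt_add_one (S t))] with s hs
    rw [mem_closedBall_zero_iff, pi_norm_le_iff_of_nonneg]
    · intro i
      have := sq_ithLargestEig_le (hsymm s) i
      rw [Real.norm_eq_abs]
      nlinarith [sq_abs (ithLargestEig (M s) i), sq_nonneg (|ithLargestEig (M s) i| - 1)]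
    · have : 0 ≤ S t := Finset.sum_nonneg fun a _ => Finset.sum_nonneg fun c _ => sq_nonneg _
      linarith
  · intro μ _ hclus
    obtain ⟨U, hU, hlim⟩ := mapClusterPt_iff_ultrafilter.1 hclus
    have hcoord : ∀ i, Tendsto (fun s => ithLargestEig (M s) i) U (𝓝 (μ i)) :=
      fun i => (tendsto_pi_nhds.1 hlim) i
    have hμ : Antitone μ := fun a b hab => le_of_tendsto_of_tendsto' (hcoord b) (hcoord a)
      fun s => (antitone_ithLargestEig_and_charpoly_eq (hsymm s)).1 hab
    have hch : (M t).charpoly = ∏ j, (X - C (μ j)) := by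
      refine Polynomial.funext fun x => ?_
      have h1 : Tendsto (fun s => eval x (M s).charpoly) U (𝓝 (∏ j, (x - μ j))) := by
        have : (fun s => eval x (M s).charpoly) = fun s => ∏ j, (x - ithLargestEig (M s) j) := by
          funext s
          rw [(antitone_ithLargestEig_and_charpoly_eq (hsymm s)).2, Polynomial.eval_prod]
          simp
        rw [this]
        exact tendsto_finsetProd _ fun j _ => (hcoord j).const_sub x
      have h2 : Tendsto (fun s => eval x (M s).charpoly) U (𝓝 (eval x (M t).charpoly)) := by
        simp_rw [Matrix.eval_charpoly]
        have : Continuous fun s => (Matrix.scalar (Fin n) x - M s).det := by fun_prop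
        exact (this.tendsto t).mono_left hU
      rw [tendsto_nhds_unique h2 h1, Polynomial.eval_prod]
      simp
    funext i
    exact (ithLargestEig_eq_of_charpoly_eq_prod hμ hch i).symm

lemma exists_mulVec_sub_smul_eq {k : ℕ} {A : Matrix (Fin k) (Fin k) ℝ} (hA : A.IsHermitian)
    {h : Fin k → ℝ} (hinj : Function.Injective h) {v : Fin k → Fin k → ℝ} (hv : ∀ i, v i ≠ 0)
    (hAv : ∀ i, A *ᵥ v i = h i • v i) (i : Fin k) {y : Fin k → ℝ} (hy : v i ⬝ᵥ y = 0) :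
    ∃ u, A *ᵥ u - h i • u = y ∧ v i ⬝ᵥ u = 0 := by
  have hT : Aᵀ = A := by simpa [IsSymm] using hA
  have horth : ∀ a b, a ≠ b → v a ⬝ᵥ v b = 0 := by
    intro a b hab
    have h1 : v a ⬝ᵥ (A *ᵥ v b) = (A *ᵥ v a) ⬝ᵥ v b := by
      rw [Matrix.dotProduct_mulVec, ← Matrix.mulVec_transpose, hT]
    rw [hAv, hAv, dotProduct_smul, smul_dotProduct] at h1
    have h2 : (h b - h a) * (v a ⬝ᵥ v b) = 0 := by
      rw [smul_eq_mul, smul_eq_mul] at h1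
      linear_combination h1
    rcases mul_eq_zero.1 h2 with h3 | h3
    · exact absurd (hinj (by linarith)) hab
    · exact h3
  have hpos : ∀ a, v a ⬝ᵥ v a ≠ 0 := fun a => by simpa using hv a
  have hli : LinearIndependent ℝ v :=
    Module.End.eigenvectors_linearIndependent' (Matrix.toLin' A) h hinj v
      fun a => ⟨by simp [hAv], hv a⟩
  have : Nonempty (Fin k) := ⟨i⟩
  let b := basisOfLinearIndependentOfCardEqFinrank hli (by simp)
  have hb : ∀ a, b a = v a := fun a => by simp [b]
  have hsum : y = ∑ a, b.repr y a • v a := by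
    conv_lhs => rw [← b.sum_repr y]
    simp [hb]
  have hci : b.repr y i = 0 := by
    have h1 := hy
    rw [hsum, dotProduct_sum, Finset.sum_eq_single i] at h1
    · simpa [dotProduct_smul, hv i] using h1
    · intro a _ ha
      simp [dotProduct_smul, horth i a ha.symm]
    · simp
  refine ⟨∑ a, (b.repr y a / (h a - h i)) • v a, ?_, ?_⟩
  · rw [Matrix.mulVec_sum, Finset.smul_sum, ← Finset.sum_sub_distrib]
    conv_rhs => rw [hsum]
    refine Finset.sum_congr rfl fun a _ => ?_
    rw [Matrix.mulVec_smul, hAv, smul_smul, smul_smul, ← sub_smul]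
    congr 1
    by_cases ha : a = i
    · simp [ha, hci]
    · have : h a - h i ≠ 0 := sub_ne_zero.2 fun hc => ha (hinj hc)
      field_simp
  · rw [dotProduct_sum]
    refine Finset.sum_eq_zero fun a _ => ?_
    by_cases ha : a = i
    · simp [ha, hci]
    · simp [dotProduct_smul, horth i a (Ne.symm ha)]

/-- First-order perturbation of the simple eigenvalues of a symmetric matrix. -/
lemma tendsto_ithLargestEig_perturbation {k : ℕ} {A Z : Matrix (Fin k) (Fin k) ℝ}
    (hA : A.IsHermitian) (hZ : Z.IsHermitian)
    {h : Fin k → ℝ} (hanti : StrictAnti h) {v : Fin k → Fin k → ℝ} (hv : ∀ i, v i ≠ 0)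
    (hAv : ∀ i, A *ᵥ v i = h i • v i) (i : Fin k) :
    Tendsto (fun ε : ℝ => ε⁻¹ * (ithLargestEig (A + ε • Z) i - h i)) (𝓝[>] 0)
      (𝓝 ((v i ⬝ᵥ Z *ᵥ v i) / (v i ⬝ᵥ v i))) := by
  set m : Fin k → ℝ := fun a => (v a ⬝ᵥ Z *ᵥ v a) / (v a ⬝ᵥ v a) with hm
  have hpos : ∀ a, 0 < v a ⬝ᵥ v a := fun a => by
    have h0 : 0 ≤ v a ⬝ᵥ v a := Finset.sum_nonneg fun c _ => mul_self_nonneg _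
    exact lt_of_le_of_ne h0 (Ne.symm (by simpa using hv a))
  have hherm : ∀ ε : ℝ, (A + ε • Z).IsHermitian := fun ε => hA.add (by
    unfold IsHermitian; rw [conjTranspose_smul, hZ.eq]; simp)
  have hres : ∀ a, ∃ K : ℝ, ∀ ε : ℝ, ∃ j,
      |ithLargestEig (A + ε • Z) j - (h a + ε * m a)| ≤ K * ε ^ 2 := by
    intro a
    have hy : v a ⬝ᵥ (m a • v a - Z *ᵥ v a) = 0 := by
      rw [dotProduct_sub, dotProduct_smul, smul_eq_mul, hm, div_mul_cancel₀ _ (hpos a).ne', sub_self]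
    obtain ⟨u, hu, hvu⟩ := exists_mulVec_sub_smul_eq hA hanti.injective hv hAv a hy
    set z := Z *ᵥ u - m a • u
    have hz : 0 ≤ z ⬝ᵥ z := Finset.sum_nonneg fun c _ => mul_self_nonneg _
    have huu : 0 ≤ u ⬝ᵥ u := Finset.sum_nonneg fun c _ => mul_self_nonneg _
    refine ⟨√(z ⬝ᵥ z / (v a ⬝ᵥ v a)), fun ε => ?_⟩
    set w := v a + ε • u
    have hww : w ⬝ᵥ w = v a ⬝ᵥ v a + ε ^ 2 * (u ⬝ᵥ u) := by
      simp only [w, add_dotProduct, dotProduct_add, dotProduct_smul, smul_dotProduct, smul_eq_mul,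
        hvu, dotProduct_comm u (v a)]
      ring
    have hle : v a ⬝ᵥ v a ≤ w ⬝ᵥ w := by rw [hww]; nlinarith [mul_nonneg (sq_nonneg ε) huu]
    have hw : w ≠ 0 := by
      intro h0
      rw [h0] at hle
      simp at hle
      linarith [hpos a]
    have hAw : (A + ε • Z) *ᵥ w - (h a + ε * m a) • w = ε ^ 2 • z := by
      have hAu : A *ᵥ u = h a • u + (m a • v a - Z *ᵥ v a) := by rw [← hu]; abel
      simp only [w, z, add_mulVec, mulVec_add, mulVec_smul, smul_mulVec, hAv, hAu]
      module
    obtain ⟨j, hj⟩ := exists_ithLargestEig_near (hherm ε) hw (h a + ε * m a)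
    refine ⟨j, ?_⟩
    rw [hAw, dotProduct_smul, smul_dotProduct, smul_eq_mul, smul_eq_mul] at hj
    have h2 : (ithLargestEig (A + ε • Z) j - (h a + ε * m a)) ^ 2 * (v a ⬝ᵥ v a)
        ≤ ε ^ 2 * (ε ^ 2 * (z ⬝ᵥ z)) := (mul_le_mul_of_nonneg_left hle (sq_nonneg _)).trans hj
    refine abs_le_of_sq_le_sq ?_ (by positivity)
    rw [mul_pow, Real.sq_sqrt (div_nonneg hz (hpos a).le), div_mul_eq_mul_div,
      le_div_iff₀ (hpos a)]
    linarith
  choose K hK using hres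
  have hsep : ∀ᶠ ε : ℝ in 𝓝 0, ∀ a b, a < b →
      h b + ε * m b + K b * ε ^ 2 < h a + ε * m a - K a * ε ^ 2 := by
    refine eventually_all.2 fun a => eventually_all.2 fun b => ?_
    by_cases hab : a < b
    · have h1 : ContinuousAt (fun ε : ℝ => h b + ε * m b + K b * ε ^ 2) 0 := by fun_prop
      have h2 : ContinuousAt (fun ε : ℝ => h a + ε * m a - K a * ε ^ 2) 0 := by fun_prop
      filter_upwards [h1.eventually_lt h2 (by simpa using hanti hab)] with ε hε _ using hε
    · exact Eventually.of_forall fun ε hc => absurd hc hab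
  have hbound : ∀ᶠ ε : ℝ in 𝓝 0,
      |ithLargestEig (A + ε • Z) i - (h i + ε * m i)| ≤ K i * ε ^ 2 := by
    filter_upwards [hsep] with ε hε
    choose j hj using fun a => hK a ε
    have hmono : StrictMono j := by
      intro a b hab
      by_contra hcon
      have h1 := (antitone_ithLargestEig_and_charpoly_eq (hherm ε)).1 (not_lt.1 hcon)
      have h2 := abs_le.1 (hj a)
      have h3 := abs_le.1 (hj b)
      linarith [hε a b hab]
    have := hj i
    rwa [hmono.eq_id] at this
  rw [tendsto_iff_norm_sub_tendsto_zero]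
  have hz : Tendsto (fun ε : ℝ => K i * ε) (𝓝[>] 0) (𝓝 0) := by
    have : ContinuousAt (fun ε : ℝ => K i * ε) 0 := by fun_prop
    simpa using this.tendsto.mono_left nhdsWithin_le_nhds
  refine tendsto_of_tendsto_of_tendsto_of_le_of_le' tendsto_const_nhds hz
    (Eventually.of_forall fun _ => norm_nonneg _) ?_
  filter_upwards [nhdsWithin_le_nhds hbound, self_mem_nhdsWithin] with ε hε hε0
  have hε0 : 0 < ε := hε0
  have : ε⁻¹ * (ithLargestEig (A + ε • Z) i - h i) - m i
      = ε⁻¹ * (ithLargestEig (A + ε • Z) i - (h i + ε * m i)) := by field_simp; ring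
  rw [Real.norm_eq_abs, this, abs_mul, abs_of_pos (inv_pos.2 hε0), inv_mul_le_iff₀ hε0]
  linarith

lemma isHermitian_symTridiagOf {k : ℕ} (d : Fin k → ℝ) (e : Fin (k - 1) → ℝ) :
    (symTridiagOf d e).IsHermitian := by
  ext a c
  simp only [symTridiagOf, conjTranspose_apply, of_apply, star_trivial]
  by_cases h1 : a = c
  · simp [h1]
  · rw [if_neg (Ne.symm h1), if_neg h1]
    split_ifs <;> first | rfl | omega

lemma continuous_symTridiagOf {k : ℕ} :
    Continuous fun p : (Fin k → ℝ) × (Fin (k - 1) → ℝ) => symTridiagOf p.1 p.2 := by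
  refine continuous_pi fun a => continuous_pi fun c => ?_
  simp only [symTridiagOf, of_apply]
  split_ifs <;> fun_prop

lemma symTridiagOf_mulVec_apply {k : ℕ} (d : Fin k → ℝ) (e : Fin (k - 1) → ℝ) (v : Fin k → ℝ)
    (a : Fin k) : (symTridiagOf d e *ᵥ v) a = d a * v a
      + (∑ l, if finL l = a then e l * v (finR l) else 0)
      + ∑ l, if finR l = a then e l * v (finL l) else 0 := by
  have hsplit : ∀ c, symTridiagOf d e a c = (if a = c then d a else 0)
      + (∑ l, if finL l = a ∧ finR l = c then e l else 0)
      + ∑ l, if finR l = a ∧ finL l = c then e l else 0 := by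
    intro c
    have ha := a.isLt
    have hc := c.isLt
    have hL : ∀ a c : Fin k, (∑ l, if finL l = a ∧ finR l = c then e l else 0)
        = if h : (a : ℕ) + 1 = c then e ⟨a, by have := c.isLt; omega⟩ else 0 := by
      intro a c
      split_ifs with h
      · have := c.isLt
        rw [Finset.sum_eq_single ⟨a, by omega⟩]
        · rw [if_pos]
          constructor <;> ext <;> simp [finL, finR, h]
        · intro l _ hl
          rw [if_neg]
          rintro ⟨h1, -⟩
          exact hl (by ext; simpa [finL] using congrArg Fin.val h1)
        · simp
      · refine Finset.sum_eq_zero fun l _ => if_neg ?_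
        rintro ⟨rfl, rfl⟩
        exact h rfl
    simp only [and_comm (b := finL _ = c)]
    rw [hL, hL]
    simp only [symTridiagOf, of_apply, Fin.ext_iff]
    split_ifs <;> first | omega | simp
  simp only [mulVec, dotProduct, hsplit, add_mul, Finset.sum_add_distrib, Finset.sum_mul]
  congr 1
  · congr 1
    · simp
    · rw [Finset.sum_comm]
      refine Finset.sum_congr rfl fun l _ => ?_
      by_cases h : finL l = a <;> simp [h]
  · rw [Finset.sum_comm]
    refine Finset.sum_congr rfl fun l _ => ?_
    by_cases h : finR l = a <;> simp [h]

lemma dotProduct_symTridiagOf_mulVec {k : ℕ} (d : Fin k → ℝ) (e : Fin (k - 1) → ℝ)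
    (v : Fin k → ℝ) : v ⬝ᵥ symTridiagOf d e *ᵥ v
      = ∑ a, v a ^ 2 * d a + ∑ l, 2 * (v (finL l) * v (finR l)) * e l := by
  have hswap : ∀ (φ ψ : Fin (k - 1) → Fin k),
      ∑ a, v a * (∑ l, if φ l = a then e l * v (ψ l) else 0) = ∑ l, v (φ l) * v (ψ l) * e l := by
    intro φ ψ
    simp only [Finset.mul_sum, mul_ite, mul_zero]
    rw [Finset.sum_comm]
    refine Finset.sum_congr rfl fun l _ => ?_
    rw [Finset.sum_ite_eq, if_pos (Finset.mem_univ _)]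
    ring
  simp only [dotProduct, symTridiagOf_mulVec_apply, mul_add, Finset.sum_add_distrib, hswap]
  rw [add_assoc, ← Finset.sum_add_distrib]
  congr 1
  · exact Finset.sum_congr rfl fun a _ => by ring
  · exact Finset.sum_congr rfl fun l _ => by ring

lemma Hpoly_three_term (n : ℕ) (x : ℝ) :
    √(((n : ℝ) + 2) / 2) * Hpoly (n + 2) x + √(((n : ℝ) + 1) / 2) * Hpoly n x
      = x * Hpoly (n + 1) x := by
  have : √(((n : ℝ) + 2) / 2) ≠ 0 := by positivity
  rw [Hpoly]
  field_simp
  ring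

lemma Hpoly_zero_pos (x : ℝ) : 0 < Hpoly 0 x := Real.rpow_pos_of_pos Real.pi_pos _

/-- The vector `(H_{k-1}(x), …, H_0(x))`. -/
def hermiteVec (k : ℕ) (x : ℝ) (j : Fin k) : ℝ := Hpoly (k - 1 - (j : ℕ)) x

lemma hermiteVec_ne_zero {k : ℕ} (hk : 1 ≤ k) (x : ℝ) : hermiteVec k x ≠ 0 := by
  intro h0
  have := congrFun h0 ⟨k - 1, by omega⟩
  simp only [hermiteVec, Nat.sub_self, Pi.zero_apply] at this
  exact (Hpoly_zero_pos x).ne' this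

lemma hermiteH_mulVec_hermiteVec {k : ℕ} {x : ℝ} (hx : Hpoly k x = 0) :
    hermiteH k *ᵥ hermiteVec k x = x • hermiteVec k x := by
  ext a
  rw [hermiteH, symTridiagOf_mulVec_apply]
  obtain ⟨a, ha⟩ := a
  obtain ⟨n, rfl⟩ : ∃ n, k = a + n + 1 := ⟨k - 1 - a, by omega⟩
  have hsumL : (∑ l : Fin (a + n + 1 - 1), if finL l = (⟨a, ha⟩ : Fin (a + n + 1)) then
      √(((a + n + 1 : ℕ) : ℝ) - 1 - (l : ℕ)) / √2 * hermiteVec (a + n + 1) x (finR l) else 0)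
      = √((n : ℝ) / 2) * Hpoly (n - 1) x := by
    rcases Nat.eq_zero_or_pos n with rfl | hn
    · simp only [Nat.cast_zero, zero_div, Real.sqrt_zero, zero_mul]
      refine Finset.sum_eq_zero fun l _ => if_neg fun hl => ?_
      have h1 : (l : ℕ) = a := by simpa [finL] using congrArg Fin.val hl
      have := l.isLt
      omega
    · rw [Finset.sum_eq_single ⟨a, by omega⟩]
      · rw [if_pos (by ext; simp [finL]), hermiteVec, Real.sqrt_div' _ zero_le_two]
        congr 2
        · congr 1; push_cast; ring
        · simp only [finR]; omega
      · intro l _ hl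
        exact if_neg fun h1 => hl (by ext; simpa [finL] using congrArg Fin.val h1)
      · simp
  have hsumR : (∑ l : Fin (a + n + 1 - 1), if finR l = (⟨a, ha⟩ : Fin (a + n + 1)) then
      √(((a + n + 1 : ℕ) : ℝ) - 1 - (l : ℕ)) / √2 * hermiteVec (a + n + 1) x (finL l) else 0)
      = √(((n : ℝ) + 1) / 2) * Hpoly (n + 1) x := by
    rcases Nat.eq_zero_or_pos a with rfl | ha0
    · rw [show n + 1 = 0 + n + 1 by ring, hx, mul_zero]
      refine Finset.sum_eq_zero fun l _ => if_neg fun hl => ?_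
      simp [finR] at hl
    · rw [Finset.sum_eq_single ⟨a - 1, by omega⟩]
      · rw [if_pos (by ext; simp [finR]; omega), hermiteVec, Real.sqrt_div' _ zero_le_two]
        congr 2
        · congr 1; push_cast [Nat.cast_sub (show 1 ≤ a by omega)]; ring
        · simp only [finL]; omega
      · intro l _ hl
        refine if_neg fun h1 => hl ?_
        have : (l : ℕ) + 1 = a := by simpa [finR] using congrArg Fin.val h1
        ext; simp; omega
      · simp
  rw [hsumL, hsumR]
  have hv : hermiteVec (a + n + 1) x ⟨a, ha⟩ = Hpoly n x := by
    simp only [hermiteVec]; congr 1; omega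
  rw [Pi.smul_apply, smul_eq_mul, hv]
  cases n with
  | zero =>
    have h2 : √(1 / 2 : ℝ) * √2 = 1 := by rw [← Real.sqrt_mul (by norm_num)]; norm_num
    simp only [Hpoly, Nat.cast_zero, zero_add, zero_div, Real.sqrt_zero, zero_mul]
    linear_combination (x * Real.pi ^ (-(1 : ℝ) / 4)) * h2
  | succ n =>
    have := Hpoly_three_term n x
    push_cast
    rw [show (n : ℝ) + 1 + 1 = n + 2 by ring]
    linarith

lemma integral_pi_gaussianReal_prod_cexp {ι : Type*} [Fintype ι] (a : ι → ℝ) (s : NNReal) (r : ℝ) :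
    ∫ x : ι → ℝ, ∏ i, Complex.exp (r * (a i * x i : ℝ) * Complex.I)
      ∂(Measure.pi fun _ => gaussianReal 0 s) = Complex.exp (-(s * ∑ i, a i ^ 2 : ℝ) * r ^ 2 / 2) := by
  rw [integral_fintype_prod_eq_prod (f := fun i (y : ℝ) =>
    Complex.exp (r * (a i * y : ℝ) * Complex.I))]
  have : ∀ i, ∫ y : ℝ, Complex.exp (r * (a i * y : ℝ) * Complex.I) ∂gaussianReal 0 s
      = Complex.exp (-(s * a i ^ 2 * r ^ 2) / 2) := by
    intro i
    have h := charFun_gaussianReal (μ := 0) (v := s) (r * a i)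
    rw [charFun_apply_real] at h
    convert h using 1
    · congr 1; ext y; congr 1; push_cast; ring
    · congr 1; push_cast; ring
  simp_rw [this, ← Complex.exp_sum]
  congr 1
  push_cast
  rw [Finset.mul_sum, ← Finset.sum_neg_distrib, Finset.sum_mul, Finset.sum_div]
  exact Finset.sum_congr rfl fun i _ => by ring

/-- A linear form in independent centered Gaussian variables is a centered Gaussian variable. -/
lemma map_linearForm_pi_gaussianReal {ι κ : Type*} [Fintype ι] [Fintype κ] (a : ι → ℝ) (b : κ → ℝ)
    (s t : NNReal) :
    Measure.map (fun p : (ι → ℝ) × (κ → ℝ) => ∑ i, a i * p.1 i + ∑ j, b j * p.2 j)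
      ((Measure.pi fun _ => gaussianReal 0 s).prod (Measure.pi fun _ => gaussianReal 0 t))
      = gaussianReal 0 (s * ∑ i, a i ^ 2 + t * ∑ j, b j ^ 2).toNNReal := by
  have hmeas : Measurable fun p : (ι → ℝ) × (κ → ℝ) => ∑ i, a i * p.1 i + ∑ j, b j * p.2 j := by
    fun_prop
  have : IsProbabilityMeasure (Measure.map (fun p : (ι → ℝ) × (κ → ℝ) =>
      ∑ i, a i * p.1 i + ∑ j, b j * p.2 j)
      ((Measure.pi fun _ => gaussianReal 0 s).prod (Measure.pi fun _ => gaussianReal 0 t))) :=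
    Measure.isProbabilityMeasure_map hmeas.aemeasurable
  refine Measure.ext_of_charFun ?_
  funext r
  rw [charFun_gaussianReal, charFun_apply_real, integral_map hmeas.aemeasurable
    (by fun_prop)]
  have hexp : ∀ p : (ι → ℝ) × (κ → ℝ),
      Complex.exp (r * ((∑ i, a i * p.1 i + ∑ j, b j * p.2 j : ℝ) : ℂ) * Complex.I)
      = (∏ i, Complex.exp (r * (a i * p.1 i : ℝ) * Complex.I)) *
        ∏ j, Complex.exp (r * (b j * p.2 j : ℝ) * Complex.I) := by
    intro p
    rw [← Complex.exp_sum, ← Complex.exp_sum, ← Complex.exp_add]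
    congr 1
    push_cast
    rw [← Finset.sum_mul, ← Finset.sum_mul, ← Finset.mul_sum, ← Finset.mul_sum]
    ring
  simp_rw [hexp]
  rw [integral_prod_mul (f := fun x : ι → ℝ => ∏ i, Complex.exp (r * (a i * x i : ℝ) * Complex.I))
    (g := fun x : κ → ℝ => ∏ j, Complex.exp (r * (b j * x j : ℝ) * Complex.I)),
    integral_pi_gaussianReal_prod_cexp, integral_pi_gaussianReal_prod_cexp,
    ← Complex.exp_add]
  congr 1
  have hnn : 0 ≤ s * ∑ i, a i ^ 2 + t * ∑ j, b j ^ 2 := by positivity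
  rw [Real.coe_toNNReal _ hnn]
  push_cast
  ring

lemma indicator_ofReal {T : Type*} (S : Set T) (f : T → ℝ) :
    (S.indicator fun x => ENNReal.ofReal (f x)) = fun x => ENNReal.ofReal (S.indicator f x) := by
  ext x
  by_cases hx : x ∈ S <;> simp [hx]

lemma pi_withDensity_ofReal {ι : Type*} [Fintype ι] {g : ι → ℝ → ℝ} (hg : ∀ j, Integrable (g j))
    (hg0 : ∀ j x, 0 ≤ g j x) :
    Measure.pi (fun j => (volume : Measure ℝ).withDensity fun x => ENNReal.ofReal (g j x))
      = (volume : Measure (ι → ℝ)).withDensity fun x => ENNReal.ofReal (∏ j, g j (x j)) := by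
  have : ∀ j, IsFiniteMeasure ((volume : Measure ℝ).withDensity fun x => ENNReal.ofReal (g j x)) :=
    fun j => isFiniteMeasure_withDensity_ofReal (hg j).2
  refine Measure.pi_eq fun s hs => ?_
  have hind : ∀ j, Integrable ((s j).indicator (g j)) := fun j => (hg j).indicator (hs j)
  have hind0 : ∀ j x, 0 ≤ (s j).indicator (g j) x :=
    fun j x => Set.indicator_nonneg (fun _ _ => hg0 j _) x
  have hprod : ∀ x : ι → ℝ, (Set.univ.pi s).indicator (fun x => ∏ j, g j (x j)) x
      = ∏ j, (s j).indicator (g j) (x j) := by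
    intro x
    by_cases hx : x ∈ Set.univ.pi s
    · rw [Set.indicator_of_mem hx]
      exact Finset.prod_congr rfl fun j _ => (Set.indicator_of_mem (hx j (Set.mem_univ j)) _).symm
    · rw [Set.indicator_of_notMem hx]
      simp only [Set.mem_pi, Set.mem_univ, true_imp_iff, not_forall] at hx
      obtain ⟨j, hj⟩ := hx
      exact (Finset.prod_eq_zero (Finset.mem_univ j) (Set.indicator_of_notMem hj _)).symm
  rw [withDensity_apply _ (MeasurableSet.univ_pi hs),
    ← lintegral_indicator (MeasurableSet.univ_pi hs), indicator_ofReal]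
  simp_rw [hprod]
  have hint : Integrable fun x : ι → ℝ => ∏ j, (s j).indicator (g j) (x j) :=
    Integrable.fintype_prod_dep hind
  rw [← ofReal_integral_eq_lintegral_ofReal hint
    (Eventually.of_forall fun x => Finset.prod_nonneg fun j _ => hind0 j _),
    integral_fintype_prod_volume_eq_prod, ENNReal.ofReal_prod_of_nonneg
      fun j _ => integral_nonneg (hind0 j)]
  refine Finset.prod_congr rfl fun j _ => ?_
  rw [withDensity_apply _ (hs j), ← lintegral_indicator (hs j), indicator_ofReal,
    ofReal_integral_eq_lintegral_ofReal (hind j) (Eventually.of_forall (hind0 j))]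

/-- Dominated convergence for integrals against products of measures with convergent densities. -/
lemma tendsto_integral_prod_pi_withDensity {Ω ι : Type*} [MeasurableSpace Ω] [Fintype ι]
    {P : Measure Ω} [IsProbabilityMeasure P] {g : ℝ → ι → ℝ → ℝ} {g' G : ι → ℝ → ℝ}
    (hgm : ∀ β j, Measurable (g β j)) (hg0 : ∀ β j x, 0 ≤ g β j x) (hg'm : ∀ j, Measurable (g' j))
    (hg'0 : ∀ j x, 0 ≤ g' j x)
    (hG : ∀ j, Integrable (G j)) (hgG : ∀ᶠ β in atTop, ∀ j x, g β j x ≤ G j x)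
    (hlim : ∀ j x, Tendsto (fun β => g β j x) atTop (𝓝 (g' j x)))
    {F : ℝ → Ω × (ι → ℝ) → ℝ} {F' : Ω × (ι → ℝ) → ℝ} {C : ℝ} (hF : ∀ β, Measurable (F β))
    (hFC : ∀ β p, |F β p| ≤ C)
    (hFlim : ∀ p, Tendsto (fun β => F β p) atTop (𝓝 (F' p))) :
    Tendsto (fun β => ∫ p, F β p ∂(P.prod
        (Measure.pi fun j => (volume : Measure ℝ).withDensity fun x => ENNReal.ofReal (g β j x))))
      atTop (𝓝 (∫ p, F' p ∂(P.prod
        (Measure.pi fun j => (volume : Measure ℝ).withDensity fun x => ENNReal.ofReal (g' j x))))) := by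
  have key : ∀ (γ : ι → ℝ → ℝ) (Φ : Ω × (ι → ℝ) → ℝ), (∀ j, Measurable (γ j)) →
      (∀ j x, 0 ≤ γ j x) → (∀ j x, γ j x ≤ G j x) →
      ∫ p, Φ p ∂(P.prod
        (Measure.pi fun j => (volume : Measure ℝ).withDensity fun x => ENNReal.ofReal (γ j x)))
      = ∫ p : Ω × (ι → ℝ), (∏ j, γ j (p.2 j)) * Φ p ∂(P.prod volume) := by
    intro γ Φ hγm hγ0 hγG
    have hγi : ∀ j, Integrable (γ j) := fun j => (hG j).mono' (hγm j).aestronglyMeasurable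
      (Eventually.of_forall fun x => by rw [Real.norm_eq_abs, abs_of_nonneg (hγ0 j x)]; exact hγG j x)
    have hm : Measurable fun x : ι → ℝ => ENNReal.ofReal (∏ j, γ j (x j)) :=
      ENNReal.measurable_ofReal.comp
        (Finset.measurable_prod _ fun j _ => (hγm j).comp (measurable_pi_apply j))
    have hfin : IsFiniteMeasure ((volume : Measure (ι → ℝ)).withDensity
        fun x => ENNReal.ofReal (∏ j, γ j (x j))) :=
      isFiniteMeasure_withDensity_ofReal (Integrable.fintype_prod_dep hγi).2
    rw [pi_withDensity_ofReal hγi hγ0, prod_withDensity_right hm,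
      integral_withDensity_eq_integral_toReal_smul (μ := P.prod volume)
        (f := fun z : Ω × (ι → ℝ) => ENNReal.ofReal (∏ j, γ j (z.2 j))) (hm.comp measurable_snd)
        (Eventually.of_forall fun _ => ENNReal.ofReal_lt_top)]
    refine integral_congr_ae (Eventually.of_forall fun p => ?_)
    simp only [smul_eq_mul]
    rw [ENNReal.toReal_ofReal (Finset.prod_nonneg fun j _ => hγ0 j _)]
  have hg'G : ∀ j x, g' j x ≤ G j x := fun j x =>
    le_of_tendsto (hlim j x) (hgG.mono fun β h => h j x)
  rw [key g' F' hg'm hg'0 hg'G]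
  refine Tendsto.congr' (f₁ := fun β => ∫ p : Ω × (ι → ℝ), (∏ j, g β j (p.2 j)) * F β p ∂(P.prod volume))
    ?_ ?_
  · filter_upwards [hgG] with β hβ
    exact (key (g β) (F β) (hgm β) (hg0 β) hβ).symm
  · refine tendsto_integral_filter_of_dominated_convergence
      (fun p : Ω × (ι → ℝ) => (∏ j, G j (p.2 j)) * C) ?_ ?_ ?_ ?_
    · refine Eventually.of_forall fun β => Measurable.aestronglyMeasurable ?_
      exact (Finset.measurable_prod _ fun j _ =>
        (hgm β j).comp ((measurable_pi_apply j).comp measurable_snd)).mul (hF β)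
    · filter_upwards [hgG] with β hβ
      refine Eventually.of_forall fun p => ?_
      rw [norm_mul, Real.norm_eq_abs, Real.norm_eq_abs,
        abs_of_nonneg (Finset.prod_nonneg fun j _ => hg0 β j _)]
      exact mul_le_mul (Finset.prod_le_prod (fun j _ => hg0 β j _) fun j _ => hβ j _) (hFC β p)
        (abs_nonneg _) (Finset.prod_nonneg fun j _ => (hg'0 j _).trans (hg'G j _))
    · exact ((Integrable.fintype_prod_dep hG).comp_snd P).mul_const C
    · exact Eventually.of_forall fun p =>
        (tendsto_finsetProd _ fun j _ => hlim j _).mul (hFlim p)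

/-- The density of the chi distribution. -/
def chiPDF (r : ℝ) : ℝ → ℝ :=
  Set.indicator (Set.Ioi (0:ℝ))
    (fun x => (2:ℝ) ^ (1 - r / 2) * x ^ (r - 1) * Real.exp (-x ^ 2 / 2) / Real.Gamma (r / 2))

lemma measurable_chiPDF (r : ℝ) : Measurable (chiPDF r) :=
  Measurable.indicator (by fun_prop) measurableSet_Ioi

lemma chiPDF_nonneg {r : ℝ} (hr : 0 < r) (x : ℝ) : 0 ≤ chiPDF r x := by
  refine Set.indicator_nonneg (fun y hy => ?_) x
  have := Real.Gamma_pos_of_pos (half_pos hr)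
  have := Real.rpow_nonneg (le_of_lt hy : (0 : ℝ) ≤ y) (r - 1)
  positivity

lemma integral_chiPDF {r : ℝ} (hr : 0 < r) : ∫ x, chiPDF r x = 1 := by
  have hΓ := (Real.Gamma_pos_of_pos (half_pos hr)).ne'
  have h := integral_rpow_mul_exp_neg_mul_rpow (p := 2) (q := r - 1) (b := 1 / 2)
    two_pos (by linarith) (by norm_num)
  rw [chiPDF, integral_indicator measurableSet_Ioi]
  have hcongr : ∀ x : ℝ, (2:ℝ) ^ (1 - r / 2) * x ^ (r - 1) * Real.exp (-x ^ 2 / 2) / Real.Gamma (r / 2)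
      = (2:ℝ) ^ (1 - r / 2) / Real.Gamma (r / 2)
        * (x ^ (r - 1) * Real.exp (-(1 / 2) * x ^ (2 : ℝ))) := by
    intro x
    rw [Real.rpow_two, show -(1 / 2 : ℝ) * x ^ 2 = -x ^ 2 / 2 by ring]
    ring
  simp_rw [hcongr]
  rw [integral_const_mul, h, show (r - 1 + 1) / 2 = r / 2 by ring,
    show -(r - 1 + 1) / 2 = -(r / 2) by ring, one_div (2 : ℝ), Real.inv_rpow zero_le_two,
    Real.rpow_neg zero_le_two, inv_inv, Real.rpow_sub two_pos, Real.rpow_one]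
  have : (2 : ℝ) ^ (r / 2) ≠ 0 := (Real.rpow_pos_of_pos two_pos _).ne'
  field_simp

lemma chiMeasure_eq_map (r c : ℝ) : chiMeasure r = Measure.map (fun x => c + x)
    ((volume : Measure ℝ).withDensity fun x => ENNReal.ofReal (chiPDF r (c + x))) := by
  ext s hs
  rw [Measure.map_apply (by fun_prop) hs, withDensity_apply _ (hs.preimage (by fun_prop)),
    ← lintegral_indicator (hs.preimage (by fun_prop))]
  change (volume.withDensity fun x => ENNReal.ofReal (chiPDF r x)) s = _
  rw [withDensity_apply _ hs, ← lintegral_indicator hs,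
    ← lintegral_add_left_eq_self (μ := (volume : Measure ℝ)) _ c]
  rfl

/-- The recentered chi density, up to normalization. -/
def chiCore (r x : ℝ) : ℝ :=
  if 0 < √r + x then (1 + x / √r) ^ (r - 1) * Real.exp (-(x * √r) - x ^ 2 / 2) else 0

lemma exists_chiPDF_eq_mul_chiCore {r : ℝ} (hr : 0 < r) :
    ∃ c, ∀ x, chiPDF r (√r + x) = c * chiCore r x := by
  refine ⟨(2:ℝ) ^ (1 - r / 2) * √r ^ (r - 1) * Real.exp (-r / 2) / Real.Gamma (r / 2), fun x => ?_⟩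
  have hs : 0 < √r := Real.sqrt_pos.2 hr
  unfold chiPDF chiCore
  by_cases hx : 0 < √r + x
  · rw [Set.indicator_of_mem (Set.mem_Ioi.2 hx), if_pos hx]
    have h1 : √r + x = √r * (1 + x / √r) := by field_simp
    have h2 : 0 ≤ 1 + x / √r := by
      by_contra! hneg
      nlinarith
    have h3 : Real.exp (-(√r + x) ^ 2 / 2) = Real.exp (-r / 2) * Real.exp (-(x * √r) - x ^ 2 / 2) := by
      rw [← Real.exp_add]
      congr 1
      nlinarith [Real.sq_sqrt hr.le]
    rw [h3, h1, Real.mul_rpow hs.le h2]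
    ring
  · rw [Set.indicator_of_notMem (by simpa using hx), if_neg hx, mul_zero]

lemma chiCore_nonneg (r x : ℝ) : 0 ≤ chiCore r x := by
  unfold chiCore
  split_ifs with hx
  · have : 0 ≤ 1 + x / √r := by
      rcases (Real.sqrt_nonneg r).eq_or_lt with h | h
      · simp [← h]
      · rw [← mul_nonneg_iff_of_pos_left h, mul_add, mul_div_cancel₀ _ h.ne']
        linarith
    have := Real.rpow_nonneg this (r - 1)
    positivity
  · exact le_rfl

lemma measurable_chiCore (r : ℝ) : Measurable (chiCore r) :=
  Measurable.ite (measurableSet_lt (by fun_prop) (by fun_prop)) (by fun_prop) (by fun_prop)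

lemma chiCore_eq_exp {r x : ℝ} (hr : 0 < r) (hx : 0 < √r + x) :
    0 < 1 + x / √r ∧
    chiCore r x = Real.exp ((r - 1) * Real.log (1 + x / √r) - x * √r - x ^ 2 / 2) := by
  have hs : 0 < √r := Real.sqrt_pos.2 hr
  have h1 : 0 < 1 + x / √r := by
    rw [← mul_pos_iff_of_pos_left hs, mul_add, mul_div_cancel₀ _ hs.ne']
    linarith
  refine ⟨h1, ?_⟩
  rw [chiCore, if_pos hx, Real.rpow_def_of_pos h1, ← Real.exp_add]
  congr 1
  ring

lemma chiCore_le {r : ℝ} (hr : 1 ≤ r) (x : ℝ) :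
    chiCore r x ≤ Real.exp 1 * Real.exp (-(1 / 2) * x ^ 2) := by
  by_cases hx : 0 < √r + x
  · obtain ⟨h1, h2⟩ := chiCore_eq_exp (by linarith) hx
    have hs : 0 < √r := Real.sqrt_pos.2 (by linarith)
    rw [h2, ← Real.exp_add]
    refine Real.exp_le_exp.2 ?_
    have h3 : (r - 1) * Real.log (1 + x / √r) ≤ (r - 1) * (x / √r) :=
      mul_le_mul_of_nonneg_left (by linarith [Real.log_le_sub_one_of_pos h1]) (by linarith)
    have h4 : r * (x / √r) = x * √r := by
      field_simp
      rw [Real.sq_sqrt (by linarith)]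
      ring
    linarith
  · rw [chiCore, if_neg hx]
    positivity

lemma tendsto_chiCore (x : ℝ) :
    Tendsto (fun r => chiCore r x) atTop (𝓝 (Real.exp (-x ^ 2))) := by
  have hy : Tendsto (fun r : ℝ => x / √r) atTop (𝓝 0) :=
    Tendsto.div_atTop tendsto_const_nhds Real.tendsto_sqrt_atTop
  have hE : Tendsto (fun r : ℝ => (r - 1) * Real.log (1 + x / √r) - x * √r - x ^ 2 / 2) atTop
      (𝓝 (-x ^ 2)) := by
    have hlog : Tendsto (fun r : ℝ => Real.log (1 + x / √r)) atTop (𝓝 0) := by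
      have : ContinuousAt (fun y : ℝ => Real.log (1 + y)) 0 :=
        (Real.continuousAt_log (by norm_num)).comp (by fun_prop)
      simpa [Function.comp_def] using this.tendsto.comp hy
    have hrem : Tendsto (fun r : ℝ =>
        r * (-(x / √r) + (x / √r) ^ 2 / 2 + Real.log (1 + x / √r))) atTop (𝓝 0) := by
      have hb : Tendsto (fun r : ℝ => x ^ 2 * (|x / √r| / (1 - |x / √r|))) atTop (𝓝 0) := by
        have : ContinuousAt (fun y : ℝ => x ^ 2 * (|y| / (1 - |y|))) 0 := by
          refine ContinuousAt.mul (by fun_prop) (ContinuousAt.div (by fun_prop) (by fun_prop) ?_)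
          simp
        simpa [Function.comp_def] using this.tendsto.comp hy
      refine squeeze_zero_norm' ?_ hb
      have habs : Tendsto (fun r : ℝ => |x / √r|) atTop (𝓝 0) := by simpa using hy.abs
      filter_upwards [habs.eventually_lt_const one_pos, eventually_gt_atTop 0] with r h1 hr
      have h2 := Real.abs_log_sub_add_sum_range_le (x := -(x / √r)) (by rwa [abs_neg]) 2
      simp only [Finset.sum_range_succ, Finset.sum_range_zero, abs_neg, sub_neg_eq_add] at h2
      norm_num at h2
      rw [Real.norm_eq_abs, abs_mul, abs_of_pos hr]
      have h3 : r * |x / √r| ^ 2 = x ^ 2 := by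
        rw [sq_abs, div_pow, Real.sq_sqrt hr.le]
        field_simp
      have h4 : x ^ 2 * (|x / √r| / (1 - |x / √r|)) = r * (|x / √r| ^ 3 / (1 - |x / √r|)) := by
        rw [← h3]; ring
      rw [h4]
      refine mul_le_mul_of_nonneg_left ?_ hr.le
      simpa only [abs_div, abs_of_nonneg (Real.sqrt_nonneg r)] using h2
    have hsum := (hrem.sub hlog).sub (tendsto_const_nhds (x := x ^ 2))
    rw [sub_zero, zero_sub] at hsum
    refine hsum.congr' ?_
    filter_upwards [eventually_gt_atTop 0] with r hr
    have hs : 0 < √r := Real.sqrt_pos.2 hr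
    have h4 : r * (x / √r) = x * √r := by
      field_simp
      rw [Real.sq_sqrt hr.le]
      ring
    have h3 : r * (x / √r) ^ 2 = x ^ 2 := by
      rw [div_pow, Real.sq_sqrt hr.le]
      field_simp
    linear_combination (-1 : ℝ) * h4 + (1 / 2 : ℝ) * h3
  refine ((Real.continuous_exp.tendsto _).comp hE).congr' ?_
  filter_upwards [Real.tendsto_sqrt_atTop.eventually_gt_atTop (-x), eventually_gt_atTop 0] with r h1 hr
  exact (chiCore_eq_exp hr (by linarith)).2.symm

lemma tendsto_integral_chiCore : Tendsto (fun r => ∫ x, chiCore r x) atTop (𝓝 (√Real.pi)) := by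
  have hpi : √Real.pi = ∫ x : ℝ, Real.exp (-x ^ 2) := by
    simpa using (integral_gaussian 1).symm
  rw [hpi]
  refine tendsto_integral_filter_of_dominated_convergence
    (fun x => Real.exp 1 * Real.exp (-(1 / 2) * x ^ 2)) ?_ ?_ ?_ ?_
  · exact Eventually.of_forall fun r => (measurable_chiCore r).aestronglyMeasurable
  · filter_upwards [eventually_ge_atTop 1] with r hr
    refine Eventually.of_forall fun x => ?_
    rw [Real.norm_eq_abs, abs_of_nonneg (chiCore_nonneg r x)]
    exact chiCore_le hr x
  · exact (integrable_exp_neg_mul_sq (by norm_num)).const_mul _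
  · exact Eventually.of_forall tendsto_chiCore

lemma chiPDF_sqrt_add_eq {r : ℝ} (hr : 0 < r) (x : ℝ) :
    chiPDF r (√r + x) = (∫ y, chiCore r y)⁻¹ * chiCore r x := by
  obtain ⟨c, hc⟩ := exists_chiPDF_eq_mul_chiCore hr
  have h1 : c * ∫ y, chiCore r y = 1 := by
    rw [← integral_const_mul, ← integral_chiPDF hr, ← integral_add_left_eq_self (chiPDF r) (√r)]
    simp_rw [hc]
  rw [hc, eq_inv_of_mul_eq_one_left h1]

/-- The chi distribution recentered at `√r` has density converging to that of `N(0,1/2)`. -/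
lemma tendsto_chiPDF_sqrt_add (x : ℝ) :
    Tendsto (fun r => chiPDF r (√r + x)) atTop (𝓝 (gaussianPDFReal 0 (1 / 2) x)) := by
  have h := (tendsto_integral_chiCore.inv₀ (Real.sqrt_pos.2 Real.pi_pos).ne').mul (tendsto_chiCore x)
  have heq : gaussianPDFReal 0 (1 / 2) x = (√Real.pi)⁻¹ * Real.exp (-x ^ 2) := by
    rw [gaussianPDFReal]
    push_cast
    congr 2
    · congr 1; ring
    · rw [sub_zero]; ring
  rw [heq]
  refine h.congr' ?_
  filter_upwards [eventually_gt_atTop 0] with r hr using (chiPDF_sqrt_add_eq hr x).symm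

lemma eventually_chiPDF_sqrt_add_le : ∀ᶠ r in atTop, ∀ x,
    chiPDF r (√r + x) ≤ ((√Real.pi)⁻¹ + 1) * (Real.exp 1 * Real.exp (-(1 / 2) * x ^ 2)) := by
  have h := tendsto_integral_chiCore.inv₀ (Real.sqrt_pos.2 Real.pi_pos).ne'
  filter_upwards [h.eventually_lt_const (lt_add_one _), eventually_ge_atTop 1] with r h1 hr x
  rw [chiPDF_sqrt_add_eq (by linarith)]
  exact mul_le_mul h1.le (chiCore_le hr x) (chiCore_nonneg r x) (by positivity)

lemma ithLargestEig_smul {n : ℕ} {A : Matrix (Fin n) (Fin n) ℝ} (hA : A.IsHermitian) {c : ℝ}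
    (hc : 0 < c) (i : Fin n) : ithLargestEig (c • A) i = c * ithLargestEig A i := by
  obtain ⟨hanti, hchar⟩ := antitone_ithLargestEig_and_charpoly_eq hA
  refine ithLargestEig_eq_of_charpoly_eq_prod (μ := fun j => c * ithLargestEig A j)
    (fun a b hab => mul_le_mul_of_nonneg_left (hanti hab) hc.le) ?_ i
  refine Polynomial.funext fun t => ?_
  have h1 : scalar (Fin n) t - c • A = c • (scalar (Fin n) (t / c) - A) := by
    rw [smul_sub]
    congr 1
    ext a b
    by_cases hab : a = b
    · simp [hab, mul_div_cancel₀ _ hc.ne']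
    · simp [hab]
  rw [eval_charpoly, h1, det_smul, ← eval_charpoly, hchar, eval_prod, eval_prod, Fintype.card,
    ← Finset.prod_const, ← Finset.prod_mul_distrib]
  refine Finset.prod_congr rfl fun j _ => ?_
  simp only [eval_sub, eval_X, eval_C]
  field_simp

lemma smul_symTridiagOf {k : ℕ} (c : ℝ) (d : Fin k → ℝ) (e : Fin (k - 1) → ℝ) :
    c • symTridiagOf d e = symTridiagOf (fun a => c * d a) (fun l => c * e l) := by
  ext a b
  simp only [symTridiagOf, Matrix.smul_apply, of_apply, smul_eq_mul]
  split_ifs <;> simp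

lemma symTridiagOf_add {k : ℕ} (d d' : Fin k → ℝ) (e e' : Fin (k - 1) → ℝ) :
    symTridiagOf d e + symTridiagOf d' e'
      = symTridiagOf (fun a => d a + d' a) (fun l => e l + e' l) := by
  ext a b
  simp only [symTridiagOf, Matrix.add_apply, of_apply]
  split_ifs <;> simp

lemma symTridiagOf_diag_superdiag {k : ℕ} (d : Fin k → ℝ) (e : Fin (k - 1) → ℝ) :
    symTridiagOf (fun a => symTridiagOf d e a a) (fun l => symTridiagOf d e (finL l) (finR l))
      = symTridiagOf d e := by
  have h1 : ∀ a, symTridiagOf d e a a = d a := fun a => by simp [symTridiagOf]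
  have h2 : ∀ l, symTridiagOf d e (finL l) (finR l) = e l := fun l => by
    simp [symTridiagOf, finL, finR]
  simp_rw [h1, h2]

lemma measurable_symTridiagOf {k : ℕ} :
    Measurable fun p : (Fin k → ℝ) × (Fin (k - 1) → ℝ) => symTridiagOf p.1 p.2 :=
  measurable_pi_iff.2 fun a => measurable_pi_iff.2 fun b =>
    (continuous_symTridiagOf.matrix_elem a b).measurable

lemma measurable_smul_symTridiagOf {k : ℕ} (c : ℝ) :
    Measurable fun p : (Fin k → ℝ) × (Fin (k - 1) → ℝ) => c • symTridiagOf p.1 p.2 :=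
  measurable_pi_iff.2 fun a => measurable_pi_iff.2 fun b =>
    ((continuous_symTridiagOf.matrix_elem a b).const_mul c).measurable

lemma measurable_ithLargestEig_symTridiagOf {k : ℕ} (i : Fin k) :
    Measurable fun p : (Fin k → ℝ) × (Fin (k - 1) → ℝ) => ithLargestEig (symTridiagOf p.1 p.2) i :=
  ((continuous_apply i).comp (continuous_ithLargestEig_comp continuous_symTridiagOf
    fun p => isHermitian_symTridiagOf p.1 p.2)).measurable

lemma measurable_ithLargestEig_smul_symTridiagOf {k : ℕ} (c : ℝ) (i : Fin k) :
    Measurable fun p : (Fin k → ℝ) × (Fin (k - 1) → ℝ) =>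
      ithLargestEig (c • symTridiagOf p.1 p.2) i := by
  simp_rw [smul_symTridiagOf]
  exact (measurable_ithLargestEig_symTridiagOf i).comp
    (f := fun p : (Fin k → ℝ) × (Fin (k - 1) → ℝ) => (fun a => c * p.1 a, fun l => c * p.2 l))
    (by fun_prop)

lemma aemeasurable_ithLargestEig_hermiteLaw (k : ℕ) (β : ℝ) (i : Fin k) :
    AEMeasurable (fun A => ithLargestEig A i) (hermiteLaw k β) := by
  have hentry : ∀ a b : Fin k, Measurable fun M : Matrix (Fin k) (Fin k) ℝ => M a b :=
    fun a b => (measurable_pi_apply b).comp (measurable_pi_apply a)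
  have hcoord : Measurable fun M : Matrix (Fin k) (Fin k) ℝ =>
      ((fun a => M a a, fun l => M (finL l) (finR l)) : (Fin k → ℝ) × (Fin (k - 1) → ℝ)) :=
    (measurable_pi_iff.2 fun a => hentry a a).prodMk (measurable_pi_iff.2 fun l => hentry _ _)
  refine ⟨_, (measurable_ithLargestEig_symTridiagOf i).comp hcoord, ?_⟩
  have h : ∀ᵐ M ∂hermiteLaw k β, ∀ a b : Fin k,
      symTridiagOf (fun a => M a a) (fun l => M (finL l) (finR l)) a b = M a b := by
    refine ae_all_iff.2 fun a => ae_all_iff.2 fun b => ?_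
    have hset : MeasurableSet {M : Matrix (Fin k) (Fin k) ℝ |
        symTridiagOf (fun a => M a a) (fun l => M (finL l) (finR l)) a b = M a b} :=
      measurableSet_eq_fun ((hentry a b).comp (measurable_symTridiagOf.comp hcoord)) (hentry a b)
    refine (ae_map_iff (measurable_smul_symTridiagOf _).aemeasurable hset).2 ?_
    refine Eventually.of_forall fun p => ?_
    simp_rw [smul_symTridiagOf, symTridiagOf_diag_superdiag]
  filter_upwards [h] with M hM
  simp only [Function.comp_apply]
  rw [show symTridiagOf (fun a => M a a) (fun l => M (finL l) (finR l)) = M from Matrix.ext hM]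

lemma integrable_chiPDF {r : ℝ} (hr : 0 < r) : Integrable (chiPDF r) :=
  Integrable.of_integral_ne_zero (by rw [integral_chiPDF hr]; exact one_ne_zero)

lemma pi_chiMeasure_div_eq_map {ι : Type*} [Fintype ι] {r : ι → ℝ} (hr : ∀ j, 0 < r j) :
    Measure.pi (fun j => Measure.map (fun x => x / √2) (chiMeasure (r j)))
      = Measure.map (fun x j => (√(r j) + x j) / √2) (Measure.pi fun j =>
        (volume : Measure ℝ).withDensity fun x => ENNReal.ofReal (chiPDF (r j) (√(r j) + x))) := by
  have hfin : ∀ j, IsFiniteMeasure ((volume : Measure ℝ).withDensity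
      fun x => ENNReal.ofReal (chiPDF (r j) (√(r j) + x))) := fun j =>
    isFiniteMeasure_withDensity_ofReal ((integrable_chiPDF (hr j)).comp_add_left _).2
  rw [Measure.pi_map_pi (f := fun j x => (√(r j) + x) / √2) fun j => by fun_prop]
  congr 1
  funext j
  rw [chiMeasure_eq_map (r j) (√(r j)), Measure.map_map (by fun_prop) (by fun_prop)]
  rfl

lemma integral_map_hermiteLaw {k : ℕ} {β : ℝ} (hβ : 0 < β) (i : Fin k) (c : ℝ)
    (f : BoundedContinuousFunction ℝ ℝ) :
    ∫ x, f x ∂(Measure.map (fun A => √β * (ithLargestEig A i - c)) (hermiteLaw k β))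
      = ∫ p : (Fin k → ℝ) × (Fin (k - 1) → ℝ), f (√β * (ithLargestEig ((√(2 * (k:ℝ) * β))⁻¹ •
          symTridiagOf p.1 (fun j => (√(((k:ℝ) - 1 - (j:ℕ)) * β) + p.2 j) / √2)) i - c))
        ∂((Measure.pi fun _ : Fin k => gaussianReal 0 1).prod
          (Measure.pi fun j : Fin (k - 1) => (volume : Measure ℝ).withDensity fun x =>
            ENNReal.ofReal (chiPDF (((k:ℝ) - 1 - (j:ℕ)) * β)
              (√(((k:ℝ) - 1 - (j:ℕ)) * β) + x)))) := by
  have hr : ∀ j : Fin (k - 1), 0 < ((k:ℝ) - 1 - (j:ℕ)) * β := fun j => by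
    have hj : (j : ℕ) + 1 < k := by have := j.isLt; omega
    have : (j : ℝ) + 1 < k := by exact_mod_cast hj
    exact mul_pos (by linarith) hβ
  have hae := ((aemeasurable_ithLargestEig_hermiteLaw k β i).sub_const c).const_mul (√β)
  have hg : AEMeasurable (fun A => f (√β * (ithLargestEig A i - c))) (hermiteLaw k β) :=
    f.continuous.measurable.comp_aemeasurable hae
  have hfin : ∀ j : Fin (k - 1), IsFiniteMeasure ((volume : Measure ℝ).withDensity fun x =>
      ENNReal.ofReal (chiPDF (((k:ℝ) - 1 - (j:ℕ)) * β)
              (√(((k:ℝ) - 1 - (j:ℕ)) * β) + x))) := fun j =>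
    isFiniteMeasure_withDensity_ofReal ((integrable_chiPDF (hr j)).comp_add_left _).2
  have hshift : Measurable fun (x : Fin (k - 1) → ℝ) (j : Fin (k - 1)) =>
      (√(((k:ℝ) - 1 - (j:ℕ)) * β) + x j) / √2 := by fun_prop
  rw [integral_map hae f.continuous.aestronglyMeasurable]
  rw [hermiteLaw] at hg ⊢
  rw [integral_map (measurable_smul_symTridiagOf _).aemeasurable hg.aestronglyMeasurable,
    pi_chiMeasure_div_eq_map hr, ← Measure.map_id (μ := Measure.pi fun _ : Fin k => gaussianReal 0 1),
    Measure.map_prod_map _ _ measurable_id hshift, Measure.map_id,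
    integral_map (by fun_prop)]
  · rfl
  · exact (f.continuous.measurable.comp (((measurable_ithLargestEig_smul_symTridiagOf _ i).sub_const
      c).const_mul _)).aestronglyMeasurable

lemma tendsto_ithLargestEig_scaled {k : ℕ} (hk : 1 ≤ k) {h : Fin k → ℝ} (hanti : StrictAnti h)
    (hroot : ∀ i, Hpoly k (h i) = 0) (i : Fin k) (d : Fin k → ℝ) (x : Fin (k - 1) → ℝ) :
    Tendsto (fun β : ℝ => √β * (ithLargestEig ((√(2 * (k:ℝ) * β))⁻¹ •
        symTridiagOf d (fun j => (√(((k:ℝ) - 1 - (j:ℕ)) * β) + x j) / √2)) i - h i / √(2 * (k:ℝ))))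
      atTop (𝓝 ((√(2 * (k:ℝ)))⁻¹ *
        ((hermiteVec k (h i) ⬝ᵥ symTridiagOf d (fun j => x j / √2) *ᵥ hermiteVec k (h i)) /
          (hermiteVec k (h i) ⬝ᵥ hermiteVec k (h i))))) := by
  have hk0 : (0 : ℝ) < k := by exact_mod_cast hk
  have hs : 0 < √(2 * (k:ℝ)) := Real.sqrt_pos.2 (by positivity)
  have hpert := tendsto_ithLargestEig_perturbation (A := hermiteH k)
    (Z := symTridiagOf d fun j => x j / √2) (isHermitian_symTridiagOf _ _)
    (isHermitian_symTridiagOf _ _) hanti (fun i => hermiteVec_ne_zero hk (h i))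
    (fun i => hermiteH_mulVec_hermiteVec (hroot i)) i
  have hε : Tendsto (fun β : ℝ => (√β)⁻¹) atTop (𝓝[>] 0) :=
    tendsto_inv_atTop_nhdsGT_zero.comp Real.tendsto_sqrt_atTop
  refine ((hpert.comp hε).const_mul (√(2 * (k:ℝ)))⁻¹).congr' ?_
  filter_upwards [eventually_gt_atTop 0] with β hβ
  have hsβ : 0 < √β := Real.sqrt_pos.2 hβ
  have hmat : (√(2 * (k:ℝ) * β))⁻¹ •
        symTridiagOf d (fun j => (√(((k:ℝ) - 1 - (j:ℕ)) * β) + x j) / √2)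
      = (√(2 * (k:ℝ)))⁻¹ • (hermiteH k + (√β)⁻¹ • symTridiagOf d fun j => x j / √2) := by
    rw [hermiteH, smul_symTridiagOf, smul_symTridiagOf, symTridiagOf_add, smul_symTridiagOf,
      Real.sqrt_mul (by positivity), mul_inv]
    congr 1
    · funext a
      ring
    · funext j
      rw [Real.sqrt_mul' _ hβ.le]
      field_simp
  have hherm : (hermiteH k + (√β)⁻¹ • symTridiagOf d fun j => x j / √2).IsHermitian := by
    rw [smul_symTridiagOf]
    exact (isHermitian_symTridiagOf _ _).add (isHermitian_symTridiagOf _ _)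
  rw [hmat, ithLargestEig_smul hherm (inv_pos.2 hs), Function.comp_apply, inv_inv]
  ring

lemma pi_gaussianReal_half (ι : Type*) [Fintype ι] :
    (Measure.pi fun _ : ι => gaussianReal 0 (1 / 2))
      = Measure.pi fun _ : ι => (volume : Measure ℝ).withDensity fun x =>
          ENNReal.ofReal (gaussianPDFReal 0 (1 / 2) x) := by
  simp_rw [gaussianReal_of_var_ne_zero 0 (show (1 / 2 : NNReal) ≠ 0 by norm_num)]
  rfl

lemma tendsto_integral_map_hermiteLaw {k : ℕ} (hk : 1 ≤ k) {h : Fin k → ℝ} (hanti : StrictAnti h)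
    (hroot : ∀ i, Hpoly k (h i) = 0) (i : Fin k) (f : BoundedContinuousFunction ℝ ℝ) :
    Tendsto (fun β : ℝ => ∫ x, f x ∂(Measure.map
        (fun A => √β * (ithLargestEig A i - h i / √(2 * (k:ℝ)))) (hermiteLaw k β)))
      atTop (𝓝 (∫ p, f ((√(2 * (k:ℝ)))⁻¹ *
        ((hermiteVec k (h i) ⬝ᵥ symTridiagOf p.1 (fun j => p.2 j / √2) *ᵥ hermiteVec k (h i)) /
          (hermiteVec k (h i) ⬝ᵥ hermiteVec k (h i))))
        ∂((Measure.pi fun _ : Fin k => gaussianReal 0 1).prod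
          (Measure.pi fun _ : Fin (k - 1) => gaussianReal 0 (1 / 2))))) := by
  have hcoef : ∀ j : Fin (k - 1), 0 < (k:ℝ) - 1 - (j:ℕ) := fun j => by
    have hj : (j : ℕ) + 1 < k := by have := j.isLt; omega
    have : (j : ℝ) + 1 < k := by exact_mod_cast hj
    linarith
  have hr : ∀ j : Fin (k - 1), Tendsto (fun β : ℝ => ((k:ℝ) - 1 - (j:ℕ)) * max β 1) atTop atTop :=
    fun j => (tendsto_atTop_mono (fun β => le_max_left β 1) tendsto_id).const_mul_atTop (hcoef j)
  rw [pi_gaussianReal_half]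
  have hF : ∀ β : ℝ, Measurable fun p : (Fin k → ℝ) × (Fin (k - 1) → ℝ) =>
      f (√β * (ithLargestEig ((√(2 * (k:ℝ) * β))⁻¹ • symTridiagOf p.1
        (fun j => (√(((k:ℝ) - 1 - (j:ℕ)) * β) + p.2 j) / √2)) i - h i / √(2 * (k:ℝ)))) := fun β =>
    f.continuous.measurable.comp ((((measurable_ithLargestEig_smul_symTridiagOf _ i).comp
      (f := fun p : (Fin k → ℝ) × (Fin (k - 1) → ℝ) =>
        (p.1, fun j : Fin (k - 1) => (√(((k:ℝ) - 1 - (j:ℕ)) * β) + p.2 j) / √2))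
      (by fun_prop)).sub_const _).const_mul _)
  have hlim := tendsto_integral_prod_pi_withDensity
    (P := Measure.pi fun _ : Fin k => gaussianReal 0 1)
    (g := fun β (j : Fin (k - 1)) x => chiPDF (((k:ℝ) - 1 - (j:ℕ)) * max β 1)
      (√(((k:ℝ) - 1 - (j:ℕ)) * max β 1) + x))
    (g' := fun _ => gaussianPDFReal 0 (1 / 2))
    (G := fun _ x => ((√Real.pi)⁻¹ + 1) * (Real.exp 1 * Real.exp (-(1 / 2) * x ^ 2)))
    (fun β j => (measurable_chiPDF _).comp (by fun_prop))
    (fun β j x => chiPDF_nonneg (mul_pos (hcoef j) (lt_max_of_lt_right one_pos)) _)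
    (fun j => measurable_gaussianPDFReal 0 _) (fun j x => gaussianPDFReal_nonneg 0 _ x)
    (fun j => ((integrable_exp_neg_mul_sq (by norm_num)).const_mul _).const_mul _)
    (eventually_all.2 fun j => (hr j).eventually eventually_chiPDF_sqrt_add_le)
    (fun j x => (tendsto_chiPDF_sqrt_add x).comp (hr j)) hF
    (fun β p => f.norm_coe_le_norm _) (fun p => (f.continuous.tendsto _).comp
      (tendsto_ithLargestEig_scaled hk hanti hroot i p.1 p.2))
  refine hlim.congr' ?_
  filter_upwards [eventually_ge_atTop 1] with β hβ
  rw [integral_map_hermiteLaw (by linarith), max_eq_left hβ]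

lemma dotProduct_hermiteVec (k : ℕ) (x : ℝ) :
    hermiteVec k x ⬝ᵥ hermiteVec k x = ∑ l ∈ Finset.range k, Hpoly l x ^ 2 := by
  rw [← Finset.sum_range_reflect, Finset.sum_range]
  exact Finset.sum_congr rfl fun j _ => (sq _).symm

lemma sum_hermiteVec_pow_four (k : ℕ) (x : ℝ) :
    ∑ j, hermiteVec k x j ^ 4 = ∑ l ∈ Finset.range k, Hpoly l x ^ 4 := by
  rw [← Finset.sum_range_reflect, Finset.sum_range]
  rfl

lemma sum_hermiteVec_mul_sq (k : ℕ) (x : ℝ) :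
    ∑ l : Fin (k - 1), (hermiteVec k x (finL l) * hermiteVec k x (finR l)) ^ 2
      = ∑ l ∈ Finset.range (k - 1), Hpoly (l + 1) x ^ 2 * Hpoly l x ^ 2 := by
  rw [← Finset.sum_range_reflect, Finset.sum_range]
  refine Finset.sum_congr rfl fun l _ => ?_
  have hl := l.isLt
  simp only [hermiteVec, finL, finR]
  rw [mul_pow, show k - 1 - (l : ℕ) = k - 1 - 1 - l + 1 by omega,
    show k - 1 - ((l : ℕ) + 1) = k - 1 - 1 - l by omega]

/-- The law of `(1/√(2k)) (vᵀ Z v)/(vᵀ v)` for the vector `v` of Hermite values, where the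
off-diagonal entries of `Z` are of the form `c·N(0,t)` with `c² t = 1/4`. -/
lemma map_hermiteVec_quadraticForm {k : ℕ} {h : Fin k → ℝ} (i : Fin k) {c : ℝ} {t : NNReal}
    (ht : c ^ 2 * t = 1 / 4) :
    Measure.map (fun p : (Fin k → ℝ) × (Fin (k - 1) → ℝ) => (√(2 * (k:ℝ)))⁻¹ *
        ((hermiteVec k (h i) ⬝ᵥ symTridiagOf p.1 (fun j => p.2 j * c) *ᵥ hermiteVec k (h i)) /
          (hermiteVec k (h i) ⬝ᵥ hermiteVec k (h i))))
      ((Measure.pi fun _ : Fin k => gaussianReal 0 1).prod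
        (Measure.pi fun _ : Fin (k - 1) => gaussianReal 0 t))
      = gaussianReal 0 (((2 * (k:ℝ))⁻¹ * hermVar k h i).toNNReal) := by
  set v := hermiteVec k (h i)
  have hform : (fun p : (Fin k → ℝ) × (Fin (k - 1) → ℝ) => (√(2 * (k:ℝ)))⁻¹ *
        ((v ⬝ᵥ symTridiagOf p.1 (fun j => p.2 j * c) *ᵥ v) / (v ⬝ᵥ v)))
      = fun p => ∑ a, ((√(2 * (k:ℝ)))⁻¹ / (v ⬝ᵥ v) * v a ^ 2) * p.1 a
        + ∑ l, ((√(2 * (k:ℝ)))⁻¹ / (v ⬝ᵥ v) * (2 * c * (v (finL l) * v (finR l)))) * p.2 l := by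
    funext p
    rw [dotProduct_symTridiagOf_mulVec, mul_div_assoc', mul_div_right_comm, mul_add,
      Finset.mul_sum, Finset.mul_sum]
    congr 1 <;> exact Finset.sum_congr rfl fun _ _ => by ring
  rw [hform, map_linearForm_pi_gaussianReal]
  congr 2
  simp_rw [mul_pow, ← Finset.mul_sum, ← pow_mul]
  rw [hermVar, ← sum_hermiteVec_pow_four, ← sum_hermiteVec_mul_sq, ← dotProduct_hermiteVec,
    div_pow, inv_pow, Real.sq_sqrt (by positivity)]
  simp_rw [mul_pow]
  push_cast
  linear_combination (2 * (k:ℝ))⁻¹ / (v ⬝ᵥ v) ^ 2 * 4 *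
    (∑ l : Fin (k - 1), v (finL l) ^ 2 * v (finR l) ^ 2) * ht

lemma hermFlucLimit_eq_gaussianReal (k : ℕ) (h : Fin k → ℝ) (i : Fin k) :
    hermFlucLimit k h i = gaussianReal 0 (((2 * (k:ℝ))⁻¹ * hermVar k h i).toNNReal) := by
  rw [← map_hermiteVec_quadraticForm (c := 1) (t := 1 / 4) i (by norm_num), hermFlucLimit, zLaw,
    Measure.map_map _ measurable_symTridiagOf]
  · simp only [mul_one]
    congr 1
    funext p
    exact mul_div_assoc _ _ _
  · have hentry : ∀ a b : Fin k, Measurable fun M : Matrix (Fin k) (Fin k) ℝ => M a b :=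
      fun a b => (measurable_pi_apply b).comp (measurable_pi_apply a)
    simp only [dotProduct, mulVec]
    fun_prop

lemma map_hermite_sum_eq_gaussianReal (k : ℕ) (h : Fin k → ℝ) (i : Fin k) :
    Measure.map (fun p : (Fin k → ℝ) × (Fin (k - 1) → ℝ) =>
        (√(2 * (k:ℝ)))⁻¹ *
          ((∑ l : Fin k, (Hpoly l (h i))^2 * p.1 l) +
            2 * ∑ l : Fin (k - 1), Hpoly ((l:ℕ) + 1) (h i) * Hpoly (l:ℕ) (h i) * p.2 l) /
          (∑ l ∈ Finset.range k, (Hpoly l (h i))^2))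
      ((Measure.pi fun _ : Fin k => gaussianReal 0 1).prod
        (Measure.pi fun _ : Fin (k - 1) => gaussianReal 0 (1 / 4)))
      = gaussianReal 0 (((2 * (k:ℝ))⁻¹ * hermVar k h i).toNNReal) := by
  set S := ∑ l ∈ Finset.range k, (Hpoly l (h i))^2
  have hform : (fun p : (Fin k → ℝ) × (Fin (k - 1) → ℝ) =>
        (√(2 * (k:ℝ)))⁻¹ *
          ((∑ l : Fin k, (Hpoly l (h i))^2 * p.1 l) +
            2 * ∑ l : Fin (k - 1), Hpoly ((l:ℕ) + 1) (h i) * Hpoly (l:ℕ) (h i) * p.2 l) / S)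
      = fun p => ∑ l : Fin k, ((√(2 * (k:ℝ)))⁻¹ / S * Hpoly l (h i) ^ 2) * p.1 l
        + ∑ l : Fin (k - 1), ((√(2 * (k:ℝ)))⁻¹ / S * (2 * (Hpoly ((l:ℕ) + 1) (h i) * Hpoly (l:ℕ) (h i))))
          * p.2 l := by
    funext p
    rw [mul_div_right_comm, mul_add, Finset.mul_sum, Finset.mul_sum, Finset.mul_sum]
    congr 1 <;> exact Finset.sum_congr rfl fun _ _ => by ring
  rw [hform, map_linearForm_pi_gaussianReal]
  congr 2
  simp_rw [mul_pow, ← Finset.mul_sum, ← pow_mul]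
  rw [hermVar, Finset.sum_range, Finset.sum_range (n := k - 1), div_pow, inv_pow,
    Real.sq_sqrt (by positivity)]
  push_cast
  ring

theorem hermite_single_eig_fluctuation (k : ℕ) (hk : 1 ≤ k)
    (h : Fin k → ℝ) (hanti : StrictAnti h) (hroot : ∀ i, Hpoly k (h i) = 0) (i : Fin k) :
    (∀ f : BoundedContinuousFunction ℝ ℝ,
      Tendsto (fun β : ℝ => ∫ x, f x ∂(Measure.map
          (fun A => Real.sqrt β * (ithLargestEig A i - h i / Real.sqrt (2 * (k:ℝ))))
          (hermiteLaw k β)))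
        atTop (𝓝 (∫ x, f x ∂(hermFlucLimit k h i)))) ∧
    hermFlucLimit k h i = Measure.map (fun p : (Fin k → ℝ) × (Fin (k-1) → ℝ) =>
        (Real.sqrt (2 * (k:ℝ)))⁻¹ *
          ((∑ l : Fin k, (Hpoly l (h i))^2 * p.1 l) +
            2 * ∑ l : Fin (k-1), Hpoly ((l:ℕ) + 1) (h i) * Hpoly (l:ℕ) (h i) * p.2 l) /
          (∑ l ∈ Finset.range k, (Hpoly l (h i))^2))
      ((Measure.pi fun _ : Fin k => gaussianReal 0 1).prod
        (Measure.pi fun _ : Fin (k-1) => gaussianReal 0 (1/4))) ∧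
    hermFlucLimit k h i =
      gaussianReal 0 (((2 * (k:ℝ))⁻¹ * hermVar k h i).toNNReal) := by
  have hlim := hermFlucLimit_eq_gaussianReal k h i
  refine ⟨fun f => ?_, hlim.trans (map_hermite_sum_eq_gaussianReal k h i).symm, hlim⟩
  have ht : (√2)⁻¹ ^ 2 * ((1 / 2 : NNReal) : ℝ) = 1 / 4 := by
    rw [inv_pow, Real.sq_sqrt zero_le_two]
    push_cast
    norm_num
  rw [hlim, ← map_hermiteVec_quadraticForm (h := h) i ht, integral_map]
  · exact tendsto_integral_map_hermiteLaw hk hanti hroot i f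
  · simp_rw [dotProduct_symTridiagOf_mulVec]
    fun_prop
  · exact f.continuous.aestronglyMeasurable

end
end
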